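/- arXiv:2402.15093 — 2 statements merged into one kernel-verified Lean document; each statement's English description precedes it below -/
import Mathlib

section
/- Let l be a positive integer, n a nonzero integer, and λ a nonnegative integer. Let H_{n,λ} be the ℂ-linear span (inside the space of functions ℝ³ → ℂ) of the functions W_n^{j,u}F_{n,λ} for 0 ≤ j ≤ |n|−1 and 0 ≤ u ≤ 2l−1, where W_n^{j,u} is the Weil–Brezin transform associated to the lattice N_{2l}. Then the ℂ-dimension of the subspace H^φ_{n,λ} = {G ∈ H_{n,λ} : G ∘ φ = G} equals l|n| + 1 if |n| + λ is even, and l|n| − 1 if |n| + λ is odd. -/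
noncomputable section

abbrev H3 := ℝ × ℝ × ℝ

/-- the map φ(p,q,s) = (−p, −q, s + 1/2) -/
def phi : H3 → H3 := fun x => (-x.1, -x.2.1, x.2.2 + 1 / 2)

/-- Weil–Brezin transform associated to the lattice N_l -/
def WB (l : ℕ) (n j u : ℤ) (g : ℝ → ℂ) : H3 → ℂ := fun x =>
  Complex.exp (2 * Real.pi * Complex.I * (n : ℂ) * (x.2.2 : ℂ)) *
    ∑' k : ℤ,
      g (x.1 + (k : ℝ) + (j : ℝ) / |(n : ℝ)| + (u : ℝ) / ((l : ℝ) * (n : ℝ))) *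
        Complex.exp (2 * Real.pi * Complex.I * (n : ℂ) *
          ((((k : ℝ) + (j : ℝ) / |(n : ℝ)| + (u : ℝ) / ((l : ℝ) * (n : ℝ))) : ℝ) : ℂ) *
          (x.2.1 : ℂ))

/-- physicists' Hermite polynomials: H₀ = 1, H_{λ+1} = 2X·H_λ − H_λ' -/
def physHermite : ℕ → Polynomial ℝ
  | 0 => 1
  | (lam + 1) => 2 * Polynomial.X * physHermite lam - (physHermite lam).derivative

/-- F_{n,λ}(x) = H_λ(√(2π|n|) x) e^{−π|n|x²} -/
def Fnl (n : ℤ) (lam : ℕ) : ℝ → ℂ := fun x =>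
  (((physHermite lam).eval (Real.sqrt (2 * Real.pi * |(n : ℝ)|) * x) *
    Real.exp (-Real.pi * |(n : ℝ)| * x ^ 2) : ℝ) : ℂ)

/-- the eigenspace H_{n,λ}: span of the W_n^{j,u}F_{n,λ} (lattice N_{2l}) -/
def eigSpace (l : ℕ) (n : ℤ) (lam : ℕ) : Submodule ℂ (H3 → ℂ) :=
  Submodule.span ℂ
    {f | ∃ j u : ℕ, j < n.natAbs ∧ u < 2 * l ∧ f = WB (2 * l) n j u (Fnl n lam)}

/-- the subspace of φ-invariant elements of H_{n,λ} -/
def eigSpacePhi (l : ℕ) (n : ℤ) (lam : ℕ) : Submodule ℂ (H3 → ℂ) :=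
  eigSpace l n lam ⊓
    LinearMap.ker (LinearMap.funLeft ℂ ℂ phi - LinearMap.id)

/-- The Weil–Brezin transform depends only on the class of its two indices modulo `l * |n|`. -/
lemma WB_eq_of_dvd {l : ℕ} (hl : l ≠ 0) {n : ℤ} (hn : n ≠ 0) (g : ℝ → ℂ) {j u j' u' : ℤ}
    (h : l * n ∣ (l * n.sign * j + u) - (l * n.sign * j' + u')) :
    WB l n j u g = WB l n j' u' g := by
  obtain ⟨t, ht⟩ := h
  have hl' : (l : ℝ) ≠ 0 := by exact_mod_cast hl
  have hn' : (n : ℝ) ≠ 0 := by exact_mod_cast hn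
  have hs : (n.sign : ℝ) * |(n : ℝ)| = n := by exact_mod_cast Int.sign_mul_abs n
  have hsn : (n.sign : ℝ) ≠ 0 := by exact_mod_cast (Int.sign_eq_zero_iff_zero.not.mpr hn)
  have key : (j : ℝ) / |(n : ℝ)| + (u : ℝ) / (l * n) =
      t + ((j' : ℝ) / |(n : ℝ)| + (u' : ℝ) / (l * n)) := by
    have ht' : ((l : ℝ) * n.sign * j + u) - (l * n.sign * j' + u') = l * n * t := by
      exact_mod_cast ht
    have ha : |(n : ℝ)| = n / n.sign := by rw [eq_div_iff hsn, mul_comm, hs]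
    rw [ha]
    field_simp
    linear_combination ht'
  funext x
  simp only [WB]
  congr 1
  rw [← (Equiv.addRight t).tsum_eq (fun k : ℤ ↦
    g (x.1 + (k : ℝ) + (j' : ℝ) / |(n : ℝ)| + (u' : ℝ) / ((l : ℝ) * (n : ℝ))) * _)]
  refine tsum_congr fun k ↦ ?_
  have h1 : (k : ℝ) + (j : ℝ) / |(n : ℝ)| + (u : ℝ) / (l * n) =
      ((k + t : ℤ) : ℝ) + (j' : ℝ) / |(n : ℝ)| + (u' : ℝ) / (l * n) := by
    push_cast
    linear_combination key
  have h2 : x.1 + (k : ℝ) + (j : ℝ) / |(n : ℝ)| + (u : ℝ) / (l * n) =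
      x.1 + ((k + t : ℤ) : ℝ) + (j' : ℝ) / |(n : ℝ)| + (u' : ℝ) / (l * n) := by
    linear_combination h1
  rw [h1, h2]
  rfl

lemma WB_comp_phi (l : ℕ) (n u : ℤ) {g : ℝ → ℂ} {ε : ℂ} (hg : ∀ x, g (-x) = ε * g x) :
    WB l n 0 u g ∘ phi = ((-1) ^ n * ε) • WB l n 0 (-u) g := by
  funext x
  simp only [WB, phi, Function.comp_apply, Pi.smul_apply, smul_eq_mul]
  rw [← (Equiv.neg ℤ).tsum_eq]
  have h1 : Complex.exp (2 * Real.pi * Complex.I * n * ((x.2.2 + 1 / 2 : ℝ) : ℂ)) =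
      (-1) ^ n * Complex.exp (2 * Real.pi * Complex.I * n * (x.2.2 : ℂ)) := by
    rw [← Complex.exp_pi_mul_I, ← Complex.exp_int_mul, ← Complex.exp_add]
    congr 1
    push_cast
    ring
  rw [h1, mul_mul_mul_comm, ← tsum_mul_left (a := ε)]
  congr 1
  refine tsum_congr fun k ↦ ?_
  rw [← mul_assoc, ← hg]
  congr 2
  · simp only [Equiv.neg_apply]
    push_cast
    ring
  · simp only [Equiv.neg_apply]
    push_cast
    ring

/-- Translation by `1 / n` in the second variable. -/
def translateSnd (n : ℤ) : Module.End ℂ (H3 → ℂ) :=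
  LinearMap.funLeft ℂ ℂ fun x ↦ (x.1, x.2.1 + 1 / n, x.2.2)

lemma translateSnd_WB (l : ℕ) {n : ℤ} (hn : n ≠ 0) (u : ℤ) (g : ℝ → ℂ) :
    translateSnd n (WB l n 0 u g) =
      Complex.exp (2 * Real.pi * Complex.I * (u / (l * n))) • WB l n 0 u g := by
  have hn' : (n : ℂ) ≠ 0 := by exact_mod_cast hn
  funext x
  simp only [translateSnd, LinearMap.funLeft_apply, WB, Pi.smul_apply, smul_eq_mul]
  rw [mul_left_comm, ← tsum_mul_left (a := Complex.exp (2 * Real.pi * Complex.I * (u / (l * n))))]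
  congr 1
  refine tsum_congr fun k ↦ ?_
  rw [mul_left_comm]
  congr 1
  rw [← Complex.exp_add, Complex.exp_eq_exp_iff_exists_int]
  refine ⟨k, ?_⟩
  push_cast
  field_simp
  ring

/-- An absolutely convergent Fourier series which vanishes identically has zero coefficients. -/
lemma eq_zero_of_tsum_fourier_eq_zero {b : ℤ → ℂ} (hb : Summable b)
    (h : ∀ t : ℝ, ∑' k : ℤ, b k * Complex.exp (2 * Real.pi * Complex.I * k * t) = 0) : b = 0 := by
  have hs : Summable fun k ↦ b k • (fourier k : C(UnitAddCircle, ℂ)) :=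
    .of_norm (by simpa only [norm_smul, fourier_norm, mul_one] using hb.norm)
  have h0 : ∑' k, b k • (fourier k : C(UnitAddCircle, ℂ)) = 0 := by
    ext x
    induction x using QuotientAddGroup.induction_on with | H t => ?_
    have := ((ContinuousMap.evalCLM ℂ (t : UnitAddCircle)).hasSum hs.hasSum).tsum_eq
    simp only [ContinuousMap.evalCLM_apply] at this
    rw [← this, ContinuousMap.zero_apply, ← h t]
    refine tsum_congr fun k ↦ ?_
    simp only [ContinuousMap.smul_apply, smul_eq_mul]
    simp
  have hs' := hs.hasSum
  rw [h0] at hs'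
  funext m
  have h2 := (ContinuousMap.toLp 2 AddCircle.haarAddCircle ℂ).hasSum hs'
  have h3 := (innerSL ℂ (fourierLp (T := 1) 2 m)).hasSum h2
  simp only [map_smul, map_zero, innerSL_apply_apply,
    orthonormal_iff_ite.mp orthonormal_fourier, smul_eq_mul, mul_ite, mul_one, mul_zero] at h3
  have h4 : (fun k ↦ if m = k then b k else 0) = fun k ↦ if k = m then b m else 0 := by
    funext k
    by_cases hk : k = m
    · simp [hk]
    · simp [hk, Ne.symm hk]
  rw [h4] at h3
  exact (hasSum_ite_eq m (b m)).unique h3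

lemma WB_ne_zero (l : ℕ) {n : ℤ} (hn : n ≠ 0) (u : ℤ) {g : ℝ → ℂ}
    (hg : ∀ a : ℝ, Summable fun k : ℤ ↦ g (a + k)) {y : ℝ} (hy : g y ≠ 0) :
    WB l n 0 u g ≠ 0 := by
  intro h
  have hn' : (n : ℂ) ≠ 0 := by exact_mod_cast hn
  set c : ℝ := u / (l * n) with hc
  have hb := eq_zero_of_tsum_fourier_eq_zero (hg y) fun t ↦ by
    have := congr_fun h (y - c, t / n, 0)
    simp only [WB, Pi.zero_apply, Complex.ofReal_zero, mul_zero, Complex.exp_zero, one_mul,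
      Int.cast_zero, zero_div, add_zero, ← hc] at this
    rw [← mul_zero (Complex.exp (-(2 * Real.pi * Complex.I * c * t))), ← this, ← tsum_mul_left]
    refine tsum_congr fun k ↦ ?_
    rw [mul_left_comm, ← Complex.exp_add]
    congr 2
    · ring
    · push_cast
      field_simp
      ring
  exact hy (by simpa using congr_fun hb 0)

lemma physHermite_eval_neg (lam : ℕ) (x : ℝ) :
    (physHermite lam).eval (-x) = (-1) ^ lam * (physHermite lam).eval x := by
  suffices h : (physHermite lam).comp (-Polynomial.X) = (-1) ^ lam * physHermite lam by
    simpa using congr_arg (Polynomial.eval x) h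
  induction lam with
  | zero => simp [physHermite]
  | succ m ih =>
    have hd := congr_arg Polynomial.derivative ih
    have hc : Polynomial.derivative ((-1 : Polynomial ℝ) ^ m) = 0 := by
      simp
    rw [Polynomial.derivative_comp, Polynomial.derivative_mul, hc] at hd
    simp only [Polynomial.derivative_neg, Polynomial.derivative_X] at hd
    simp only [physHermite, Polynomial.sub_comp, Polynomial.mul_comp, Polynomial.X_comp,
      Polynomial.ofNat_comp, ih]
    linear_combination hd

lemma physHermite_ne_zero (lam : ℕ) : physHermite lam ≠ 0 := by
  suffices h : (physHermite lam).natDegree ≤ lam ∧ (physHermite lam).coeff lam = 2 ^ lam by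
    intro h0
    have := h.2
    rw [h0, Polynomial.coeff_zero] at this
    exact pow_ne_zero lam two_ne_zero this.symm
  induction lam with
  | zero => simp [physHermite]
  | succ m ih =>
    have hd : (physHermite m).derivative.natDegree ≤ m :=
      (Polynomial.natDegree_derivative_le _).trans ((Nat.sub_le _ _).trans ih.1)
    constructor
    · refine (Polynomial.natDegree_sub_le _ _).trans (max_le ?_ (hd.trans m.le_succ))
      refine Polynomial.natDegree_mul_le.trans ?_
      have : (2 * Polynomial.X : Polynomial ℝ).natDegree ≤ 1 := by compute_degree
      omega
    · rw [physHermite, Polynomial.coeff_sub, Polynomial.coeff_eq_zero_of_natDegree_lt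
        (hd.trans_lt m.lt_succ_self), mul_assoc, Polynomial.coeff_ofNat_mul, Polynomial.coeff_X_mul, ih.2]
      ring

lemma Fnl_neg (n : ℤ) (lam : ℕ) (x : ℝ) : Fnl n lam (-x) = (-1) ^ lam * Fnl n lam x := by
  simp only [Fnl, mul_neg, physHermite_eval_neg, neg_sq]
  push_cast
  ring

lemma exists_Fnl_ne_zero {n : ℤ} (hn : n ≠ 0) (lam : ℕ) : ∃ y, Fnl n lam y ≠ 0 := by
  by_contra! h
  refine physHermite_ne_zero lam (Polynomial.funext fun x ↦ ?_)
  have hr : √(2 * Real.pi * |(n : ℝ)|) ≠ 0 := by positivity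
  have := h (x / √(2 * Real.pi * |(n : ℝ)|))
  simp only [Fnl, mul_div_cancel₀ x hr, Complex.ofReal_eq_zero, mul_eq_zero, Real.exp_ne_zero,
    or_false] at this
  simpa using this

lemma summable_Fnl {n : ℤ} (hn : n ≠ 0) (lam : ℕ) (a : ℝ) :
    Summable fun k : ℤ ↦ Fnl n lam (a + k) := by
  obtain ⟨Q, hQ⟩ : ∃ Q : Polynomial ℝ, ∀ x : ℝ,
      (physHermite lam).eval (√(2 * Real.pi * |(n : ℝ)|) * (a + x)) = Q.eval x :=
    ⟨(physHermite lam).comp (Polynomial.C √(2 * Real.pi * |(n : ℝ)|) *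
      (Polynomial.C a + Polynomial.X)), fun x ↦ by simp⟩
  have hT : 0 < |(n : ℝ)| := by positivity
  refine Summable.of_norm_bounded (g := fun k : ℤ ↦ ∑ i ∈ Finset.range (Q.natDegree + 1),
    |Q.coeff i| * ((|k| ^ i : ℝ) *
      Real.exp (-Real.pi * (|(n : ℝ)| * k ^ 2 - 2 * (|(n : ℝ)| * |a|) * |k|)))) ?_ fun k ↦ ?_
  · exact summable_sum fun i _ ↦
      (summable_pow_mul_jacobiTheta₂_term_bound (|(n : ℝ)| * |a|) hT i).mul_left _
  · simp only [Fnl, hQ, Complex.norm_real, norm_mul, Real.norm_eq_abs, Real.abs_exp, ← mul_assoc]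
    rw [← Finset.sum_mul]
    gcongr ?_ * Real.exp ?_
    · rw [Polynomial.eval_eq_sum_range]
      refine (Finset.abs_sum_le_sum_abs _ _).trans_eq (Finset.sum_congr rfl fun i _ ↦ ?_)
      rw [abs_mul, abs_pow, Int.cast_abs]
    · have h1 : -(a * k) ≤ |a| * |(k : ℝ)| := by rw [← abs_mul]; exact neg_le_abs _
      have h2 : 0 ≤ Real.pi * |(n : ℝ)| := by positivity
      have h3 : Real.pi * |(n : ℝ)| * (k ^ 2 - 2 * (|a| * |(k : ℝ)|)) ≤
          Real.pi * |(n : ℝ)| * (a + k) ^ 2 :=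
        mul_le_mul_of_nonneg_left (by nlinarith [sq_nonneg a]) h2
      push_cast
      linarith

/-- For `ε = ±1`, the space of `a : ZMod N → ℂ` with `ε * a (-r) = a r`, `N` even, has dimension
`N / 2 + ε`. -/
lemma finrank_ker_smul_funLeft_neg {M : ℕ} (hM : 0 < M) {ε : ℂ} (hε : ε * ε = 1) :
    (Module.finrank ℂ (LinearMap.ker
      (ε • LinearMap.funLeft ℂ ℂ (Neg.neg : ZMod (2 * M) → ZMod (2 * M)) - LinearMap.id)) : ℂ) =
      M + ε := by
  have : NeZero (2 * M) := ⟨by omega⟩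
  set A : Module.End ℂ (ZMod (2 * M) → ℂ) := ε • LinearMap.funLeft ℂ ℂ Neg.neg with hA
  have hAA : ∀ a, A (A a) = a := fun a ↦ by
    funext r
    simp [hA, LinearMap.funLeft_apply, ← mul_assoc, hε]
  have hproj : LinearMap.IsProj (LinearMap.ker (A - LinearMap.id))
      ((1 / 2 : ℂ) • (LinearMap.id + A)) := by
    constructor
    · intro a
      simp [LinearMap.mem_ker, hAA, add_comm]
    · intro a ha
      have ha' : A a = a := by simpa [LinearMap.mem_ker, sub_eq_zero] using ha
      simp only [LinearMap.smul_apply, LinearMap.add_apply, LinearMap.id_apply, ha']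
      rw [← two_smul ℂ a, smul_smul]
      norm_num
  rw [← hproj.trace, map_smul, map_add, LinearMap.trace_id]
  have hfix : (Finset.univ.filter fun r : ZMod (2 * M) ↦ -r = r) = {0, (M : ZMod (2 * M))} := by
    ext r
    have hMv : (M : ZMod (2 * M)).val = M := ZMod.val_natCast_of_lt (by omega)
    simp only [Finset.mem_filter_univ, ZMod.neg_eq_self_iff, Finset.mem_insert,
      Finset.mem_singleton]
    refine or_congr_right ⟨fun h ↦ ZMod.val_injective _ (by omega), ?_⟩
    rintro rfl
    omega
  have hne : (0 : ZMod (2 * M)) ≠ (M : ZMod (2 * M)) := by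
    rw [ne_comm, Ne, ZMod.natCast_eq_zero_iff]
    exact fun h ↦ absurd (Nat.le_of_dvd hM h) (by omega)
  have htr : LinearMap.trace ℂ _ A = 2 * ε := by
    rw [LinearMap.trace_eq_matrix_trace ℂ (Pi.basisFun ℂ _), Matrix.trace]
    simp only [Matrix.diag_apply, LinearMap.toMatrix_apply, Pi.basisFun_apply, Pi.basisFun_repr,
      hA, LinearMap.smul_apply, Pi.smul_apply, LinearMap.funLeft_apply, smul_eq_mul,
      Pi.single_apply, mul_ite, mul_one, mul_zero]
    rw [← Finset.sum_filter, hfix, Finset.sum_pair hne]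
    ring
  rw [htr]
  simp [ZMod.card]
  ring

lemma finrank_span_inf_ker {V : Type*} [AddCommGroup V] [Module ℂ V] {M : ℕ} (hM : 0 < M)
    {B : ZMod (2 * M) → V} (hB : LinearIndependent ℂ B) {ε : ℂ} (hε : ε * ε = 1)
    {T : Module.End ℂ V} (hT : ∀ r, T (B r) = ε • B (-r)) :
    (Module.finrank ℂ (Submodule.span ℂ (Set.range B) ⊓ LinearMap.ker (T - LinearMap.id) :
      Submodule ℂ V) : ℂ) = M + ε := by
  have : NeZero (2 * M) := ⟨by omega⟩
  have hinj : Function.Injective (Fintype.linearCombination ℂ B) :=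
    linearIndependent_iff_injective_fintypeLinearCombination.mp hB
  have hcomm : ∀ a, T (Fintype.linearCombination ℂ B a) = Fintype.linearCombination ℂ B
      ((ε • LinearMap.funLeft ℂ ℂ (Neg.neg : ZMod (2 * M) → ZMod (2 * M))) a) := fun a ↦ by
    simp only [Fintype.linearCombination_apply, map_sum, map_smul, hT, LinearMap.smul_apply,
      Finset.smul_sum]
    exact Fintype.sum_equiv (Equiv.neg (ZMod (2 * M))) _ _ fun r ↦ by
      simp [smul_smul, mul_comm, LinearMap.funLeft_apply]
  suffices h : Submodule.span ℂ (Set.range B) ⊓ LinearMap.ker (T - LinearMap.id) =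
      (LinearMap.ker (ε • LinearMap.funLeft ℂ ℂ (Neg.neg : ZMod (2 * M) → ZMod (2 * M)) -
        LinearMap.id)).map (Fintype.linearCombination ℂ B) by
    rw [← finrank_ker_smul_funLeft_neg hM hε, h,
      (Submodule.equivMapOfInjective _ hinj _).finrank_eq]
  ext v
  rw [← Fintype.range_linearCombination ℂ B]
  simp only [Submodule.mem_inf, LinearMap.mem_range, LinearMap.mem_ker, Submodule.mem_map,
    LinearMap.sub_apply, LinearMap.id_apply, sub_eq_zero]
  constructor
  · rintro ⟨⟨a, rfl⟩, h⟩
    exact ⟨a, hinj (by rw [← hcomm, h]), rfl⟩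
  · rintro ⟨a, h, rfl⟩
    exact ⟨⟨a, rfl⟩, by rw [hcomm, h]⟩

lemma two_mul_natAbs_dvd_iff (l : ℕ) (n x : ℤ) :
    ((2 * (l * n.natAbs) : ℕ) : ℤ) ∣ x ↔ ((2 * l : ℕ) : ℤ) * n ∣ x := by
  rw [← Int.natAbs_dvd (a := ((2 * l : ℕ) : ℤ) * n), Int.natAbs_mul, Int.natAbs_natCast, mul_assoc]

/-- The Weil–Brezin transforms `W_n^{0,r} F_{n,λ}`, indexed by residue classes modulo `2l|n|`. -/
def eigBasis (l : ℕ) (n : ℤ) (lam : ℕ) (r : ZMod (2 * (l * n.natAbs))) : H3 → ℂ :=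
  WB (2 * l) n 0 r.cast (Fnl n lam)

lemma WB_eq_eigBasis {l : ℕ} (hl : 0 < l) {n : ℤ} (hn : n ≠ 0) (lam : ℕ) (j u : ℤ)
    {r : ZMod (2 * (l * n.natAbs))} (h : (2 * l * n.sign * j + u : ℤ) = r) :
    WB (2 * l) n j u (Fnl n lam) = eigBasis l n lam r := by
  refine WB_eq_of_dvd (by omega) hn _ ?_
  rw [← ZMod.intCast_zmod_cast r, ZMod.intCast_eq_intCast_iff_dvd_sub] at h
  rw [two_mul_natAbs_dvd_iff] at h
  rw [dvd_sub_comm]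
  exact h.trans (dvd_of_eq (by push_cast; ring))

lemma eigBasis_linearIndependent {l : ℕ} (hl : 0 < l) {n : ℤ} (hn : n ≠ 0) (lam : ℕ) :
    LinearIndependent ℂ (eigBasis l n lam) := by
  have hl' : (l : ℂ) ≠ 0 := by exact_mod_cast hl.ne'
  have hn' : (n : ℂ) ≠ 0 := by exact_mod_cast hn
  obtain ⟨y, hy⟩ := exists_Fnl_ne_zero hn lam
  have hv (r : ZMod (2 * (l * n.natAbs))) : (translateSnd n).HasEigenvector
      (Complex.exp (2 * Real.pi * Complex.I *
        (((r.cast : ℤ) : ℂ) / (((2 * l : ℕ) : ℂ) * n)))) (eigBasis l n lam r) :=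
    ⟨Module.End.mem_eigenspace_iff.mpr (translateSnd_WB (2 * l) hn r.cast (Fnl n lam)),
      WB_ne_zero (2 * l) hn r.cast (summable_Fnl hn lam) hy⟩
  refine Module.End.eigenvectors_linearIndependent' (translateSnd n) _ ?_ _ hv
  intro r s h
  obtain ⟨k, hk⟩ := Complex.exp_eq_exp_iff_exists_int.mp h
  rw [← ZMod.intCast_zmod_cast r, ← ZMod.intCast_zmod_cast s,
    ZMod.intCast_eq_intCast_iff_dvd_sub, dvd_sub_comm]
  have h2 : (r.cast : ℤ) - (s.cast : ℤ) = 2 * l * n * k := by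
    have hpi := Complex.two_pi_I_ne_zero
    have h3 : (((r.cast : ℤ) : ℂ) / (((2 * l : ℕ) : ℂ) * n)) =
        ((s.cast : ℤ) : ℂ) / (((2 * l : ℕ) : ℂ) * n) + k :=
      mul_left_cancel₀ hpi (by linear_combination hk)
    push_cast at h3
    field_simp at h3
    have h4 : ((r.cast : ℤ) : ℂ) - ((s.cast : ℤ) : ℂ) = 2 * l * n * k := by linear_combination h3
    exact_mod_cast h4
  rw [h2, two_mul_natAbs_dvd_iff]
  exact ⟨k, by push_cast; ring⟩

lemma eigSpace_eq_span_eigBasis {l : ℕ} (hl : 0 < l) {n : ℤ} (hn : n ≠ 0) (lam : ℕ) :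
    eigSpace l n lam = Submodule.span ℂ (Set.range (eigBasis l n lam)) := by
  refine congr_arg (Submodule.span ℂ) (Set.Subset.antisymm ?_ ?_)
  · rintro _ ⟨j, u, -, -, rfl⟩
    exact ⟨_, (WB_eq_eigBasis hl hn lam j u rfl).symm⟩
  · rintro _ ⟨r, rfl⟩
    set m : ℤ := r.cast with hm
    have h2l : (0 : ℤ) < 2 * l := by omega
    have hn0 : (n.natAbs : ℤ) ≠ 0 := by omega
    obtain ⟨u, hu⟩ := Int.eq_ofNat_of_zero_le (Int.emod_nonneg m h2l.ne')
    obtain ⟨j, hj⟩ := Int.eq_ofNat_of_zero_le (Int.emod_nonneg (n.sign * (m / (2 * l))) hn0)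
    have hu' := Int.emod_lt_of_pos m h2l
    have hj' := Int.emod_lt_of_pos (n.sign * (m / (2 * l))) (b := n.natAbs) (by omega)
    refine ⟨j, u, by omega, by omega, (WB_eq_eigBasis hl hn lam j u ?_).symm⟩
    have hs : n.sign * n.sign = 1 := by
      rcases hn.lt_or_gt with h | h <;> simp [Int.sign_eq_neg_one_of_neg, Int.sign_eq_one_of_pos, h]
    rw [← ZMod.intCast_zmod_cast r, ZMod.intCast_eq_intCast_iff_dvd_sub, ← hm, ← hu, ← hj,
      Int.emod_def, Int.emod_def]
    refine ⟨n.sign * (n.sign * (m / (2 * l)) / n.natAbs), ?_⟩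
    push_cast
    linear_combination (-(2 * l * (m / (2 * l))) : ℤ) * hs

/-- the dimension of the space of φ-invariant eigenfunctions in H_{n,λ}
is l|n| + 1 if |n| + λ is even and l|n| − 1 if |n| + λ is odd. -/
theorem dim_phi_invariant_eigenspace (l : ℕ) (hl : 0 < l) (n : ℤ) (hn : n ≠ 0)
    (lam : ℕ) :
    Module.finrank ℂ (eigSpacePhi l n lam) =
      if Even (n.natAbs + lam) then l * n.natAbs + 1 else l * n.natAbs - 1 := by
  have hM : 0 < l * n.natAbs := Nat.mul_pos hl (Int.natAbs_pos.mpr hn)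
  have hε : ((-1 : ℂ) ^ n * (-1) ^ lam) = (-1) ^ (n.natAbs + lam) := by
    rw [pow_add]
    congr 1
    rcases n.natAbs_eq with h | h <;> generalize n.natAbs = m at h <;> subst h
    · simp
    · rw [zpow_neg, zpow_natCast, ← inv_pow]
      norm_num
  have hT : ∀ r, LinearMap.funLeft ℂ ℂ phi (eigBasis l n lam r) =
      ((-1 : ℂ) ^ (n.natAbs + lam)) • eigBasis l n lam (-r) := fun r ↦ by
    have h := WB_comp_phi (2 * l) n r.cast (Fnl_neg n lam)
    rwa [WB_eq_eigBasis hl hn lam 0 (-r.cast) (r := -r) (by simp), hε] at h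
  have key := finrank_span_inf_ker hM (eigBasis_linearIndependent hl hn lam)
    (by rw [← mul_pow]; norm_num) hT
  rw [← eigSpace_eq_span_eigBasis hl hn] at key
  change (Module.finrank ℂ (eigSpacePhi l n lam) : ℂ) = _ at key
  split_ifs with h
  · rw [h.neg_one_pow] at key
    exact_mod_cast key
  · rw [(Nat.not_even_iff_odd.mp h).neg_one_pow] at key
    have : ((Module.finrank ℂ (eigSpacePhi l n lam) + 1 : ℕ) : ℂ) = (l * n.natAbs : ℕ) := by
      rw [Nat.cast_add, key]
      simp
    have := Nat.cast_injective this
    omega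

end
end

section
/- Let l be a positive integer, n a nonzero integer, and λ a nonnegative integer. Let H̃_{n,λ} be the ℂ-linear span (inside the space of functions ℝ³ → ℂ) of the functions W̃_n^{j,u}F_{n,λ,l} for 0 ≤ j ≤ |n|−1 and 0 ≤ u ≤ 2l−1, and let H̃^ψ_{n,λ} = {G ∈ H̃_{n,λ} : G ∘ ψ = G}. Then: (i) if |n| is even or l is even, the ℂ-dimension of H̃^ψ_{n,λ} equals l|n|/2 + 1 if |n| + λ ≡ 0 mod 4, equals l|n|/2 if |n| + λ ≡ 1 or 2 mod 4, and equals l|n|/2 − 1 if |n| + λ ≡ 3 mod 4; (ii) if |n| and l are both odd, the ℂ-dimension of H̃^ψ_{n,λ} equals (l|n| + 1)/2 if |n| + λ ≡ 0 or 2 mod 4, and equals (l|n| − 1)/2 if |n| + λ ≡ 1 or 3 mod 4. -/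
noncomputable section

/-- the map ψ(p,q,s) = (−q, p, s + 1/4 − pq) -/
def psi : H3 → H3 := fun x => (-x.2.1, x.1, x.2.2 + 1 / 4 - x.1 * x.2.1)

/-- S_{2l}(p,q,s) = (p/√(2l), √(2l)q, s) -/
def S2l (l : ℕ) : H3 → H3 := fun x =>
  (x.1 / Real.sqrt (2 * l), Real.sqrt (2 * l) * x.2.1, x.2.2)

/-- F_{n,λ,l}(x) = H_λ(2√(lπ|n|) x) e^{−2lπ|n|x²} -/
def Fnll (l : ℕ) (n : ℤ) (lam : ℕ) : ℝ → ℂ := fun x =>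
  (((physHermite lam).eval (2 * Real.sqrt ((l : ℝ) * Real.pi * |(n : ℝ)|) * x) *
    Real.exp (-2 * (l : ℝ) * Real.pi * |(n : ℝ)| * x ^ 2) : ℝ) : ℂ)

/-- W̃_n^{j,u}F_{n,λ,l} = (W_n^{j,u}F_{n,λ,l}) ∘ S_{2l} -/
def WBt (l : ℕ) (n j u : ℤ) (lam : ℕ) : H3 → ℂ := fun x =>
  WB (2 * l) n j u (Fnll l n lam) (S2l l x)

/-- the eigenspace H̃_{n,λ}: span of the W̃_n^{j,u}F_{n,λ,l} -/
def eigSpaceT (l : ℕ) (n : ℤ) (lam : ℕ) : Submodule ℂ (H3 → ℂ) :=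
  Submodule.span ℂ
    {f | ∃ j u : ℕ, j < n.natAbs ∧ u < 2 * l ∧ f = WBt l n j u lam}

/-- the subspace of ψ-invariant elements of H̃_{n,λ} -/
def eigSpacePsi (l : ℕ) (n : ℤ) (lam : ℕ) : Submodule ℂ (H3 → ℂ) :=
  eigSpaceT l n lam ⊓
    LinearMap.ker (LinearMap.funLeft ℂ ℂ psi - LinearMap.id)

theorem ofReal_mul_cpow_half {r : ℝ} (hr : 0 < r) {x : ℂ} (hx : x ≠ 0) :
    ((r : ℂ) * x) ^ (1 / 2 : ℂ) = (Real.sqrt r : ℂ) * x ^ (1 / 2 : ℂ) := by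
  have hr' : (r : ℂ) ≠ 0 := by exact_mod_cast hr.ne'
  rw [Complex.cpow_def_of_ne_zero (mul_ne_zero hr' hx), Complex.log_ofReal_mul hr hx, add_mul,
    Complex.exp_add, ← Complex.cpow_def_of_ne_zero hx, Real.sqrt_eq_rpow,
    Complex.ofReal_cpow hr.le, Complex.cpow_def_of_ne_zero hr', Complex.ofReal_log hr.le]
  norm_num

theorem neg_I_cpow_half :
    (-Complex.I) ^ (1 / 2 : ℂ) = (Real.sqrt 2 : ℂ) / 2 * (1 - Complex.I) := by
  rw [Complex.cpow_def_of_ne_zero (by simp), Complex.log_neg_I,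
    show -(Real.pi / 2 : ℂ) * Complex.I * (1 / 2) = ((-(Real.pi / 4) : ℝ) : ℂ) * Complex.I by
      push_cast; ring,
    Complex.exp_mul_I, ← Complex.ofReal_cos, ← Complex.ofReal_sin, Real.cos_neg, Real.sin_neg,
    Real.cos_pi_div_four, Real.sin_pi_div_four]
  push_cast; ring

theorem jacobiTheta_sub_two_mul_nat (x : ℂ) (k : ℕ) :
    jacobiTheta (x - 2 * k) = jacobiTheta x := by
  induction k with
  | zero => simp
  | succ k ih => rw [← ih, ← jacobiTheta_two_add]; congr 1; push_cast; ring

open Filter Topology in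
theorem tendsto_sqrt_mul_evenKernel (a : UnitAddCircle) :
    Tendsto (fun x : ℝ => Real.sqrt x * HurwitzZeta.evenKernel a x) (𝓝[>] 0) (𝓝 1) := by
  have h1 : Tendsto (HurwitzZeta.cosKernel a) atTop (𝓝 1) := by
    obtain ⟨p, hp, h⟩ := HurwitzZeta.isBigO_atTop_cosKernel_sub a
    have h0 : Tendsto (fun x : ℝ => Real.exp (-p * x)) atTop (𝓝 0) :=
      Real.tendsto_exp_atBot.comp (tendsto_id.const_mul_atTop_of_neg (neg_neg_of_pos hp))
    simpa using (h.trans_tendsto h0).add_const 1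
  refine (h1.comp tendsto_inv_nhdsGT_zero).congr' ?_
  filter_upwards [self_mem_nhdsWithin] with x hx
  have hs : Real.sqrt x ≠ 0 := (Real.sqrt_pos.mpr hx).ne'
  rw [HurwitzZeta.evenKernel_functional_equation, ← Real.sqrt_eq_rpow]
  simp only [Function.comp, one_div]
  field_simp

theorem jacobiTheta_rational_add {N : ℕ} [NeZero N] {ε : ℝ} (hε : 0 < ε) :
    jacobiTheta (2 / N + ε * Complex.I) =
      ∑ r : Fin N, Complex.exp (2 * Real.pi * Complex.I * ((r : ℕ) ^ 2 : ℕ) / N) *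
        (HurwitzZeta.evenKernel (((r : ℕ) / N : ℝ) : UnitAddCircle) (N ^ 2 * ε) : ℂ) := by
  have hN : (N : ℂ) ≠ 0 := NeZero.ne _
  have hN' : (0 : ℝ) < N := by exact_mod_cast NeZero.pos N
  have him : 0 < (2 / N + ε * Complex.I : ℂ).im := by
    have : (2 / N : ℂ) = ((2 / N : ℝ) : ℂ) := by push_cast; rfl
    rw [this]; simpa using hε
  have h1 := hasSum_jacobiTheta₂_term 0 him
  rw [← jacobiTheta_eq_jacobiTheta₂,
    ← (((Int.divModEquiv N).trans (Equiv.prodComm _ _)).symm).hasSum_iff] at h1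
  have h2 : ∀ r : Fin N, HasSum (fun k : ℤ =>
      ((fun n => jacobiTheta₂_term n 0 (2 / N + ε * Complex.I)) ∘
      ((Int.divModEquiv N).trans (Equiv.prodComm _ _)).symm) (r, k))
      (Complex.exp (2 * Real.pi * Complex.I * ((r : ℕ) ^ 2 : ℕ) / N) *
        (HurwitzZeta.evenKernel (((r : ℕ) / N : ℝ) : UnitAddCircle) (N ^ 2 * ε) : ℂ)) := by
    intro r
    have h3 := (Complex.hasSum_ofReal.mpr (HurwitzZeta.hasSum_int_evenKernel ((r : ℕ) / N : ℝ)
      (t := N ^ 2 * ε) (by positivity))).mul_left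
      (Complex.exp (2 * Real.pi * Complex.I * ((r : ℕ) ^ 2 : ℕ) / N))
    refine h3.congr_fun ?_
    intro k
    simp only [Function.comp, Equiv.symm_trans_apply, Equiv.prodComm_symm, Equiv.prodComm_apply,
      Prod.swap_prod_mk, Int.divModEquiv, Equiv.coe_fn_symm_mk, jacobiTheta₂_term]
    rw [Complex.ofReal_exp, ← Complex.exp_add, Complex.exp_eq_exp_iff_exists_int]
    refine ⟨k ^ 2 * N + 2 * k * r, ?_⟩
    push_cast
    field_simp
    linear_combination (((r : ℕ) : ℂ) + N * k) ^ 2 * N * ε * Complex.I_sq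
  exact (h1.prod_fiberwise h2).unique (hasSum_fintype _)

open Filter Topology in
theorem tendsto_sqrt_mul_jacobiTheta_rational {N : ℕ} [NeZero N] :
    Tendsto (fun ε : ℝ => (Real.sqrt ε : ℂ) * jacobiTheta (2 / N + ε * Complex.I)) (𝓝[>] 0)
      (𝓝 ((∑ r : Fin N, Complex.exp (2 * Real.pi * Complex.I * ((r : ℕ) ^ 2 : ℕ) / N)) / N)) := by
  have hN' : (0 : ℝ) < N := by exact_mod_cast NeZero.pos N
  have hsc : Tendsto (fun ε : ℝ => (N : ℝ) ^ 2 * ε) (𝓝[>] 0) (𝓝[>] 0) := by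
    refine tendsto_nhdsWithin_iff.mpr ⟨?_, ?_⟩
    · exact ((continuous_const.mul continuous_id).tendsto' _ _ (by simp)).mono_left
        nhdsWithin_le_nhds
    · filter_upwards [self_mem_nhdsWithin] with x hx
      have : 0 < x := hx
      show 0 < (N : ℝ) ^ 2 * x
      positivity
  have h : Tendsto (fun ε : ℝ => (∑ r : Fin N,
      Complex.exp (2 * Real.pi * Complex.I * ((r : ℕ) ^ 2 : ℕ) / N) *
        ((Real.sqrt (N ^ 2 * ε) * HurwitzZeta.evenKernel (((r : ℕ) / N : ℝ) : UnitAddCircle)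
          (N ^ 2 * ε) : ℝ) : ℂ)) / N) (𝓝[>] 0)
      (𝓝 ((∑ r : Fin N, Complex.exp (2 * Real.pi * Complex.I * ((r : ℕ) ^ 2 : ℕ) / N) *
        ((1 : ℝ) : ℂ)) / N)) := by
    refine Tendsto.div_const (tendsto_finsetSum _ fun r _ => Tendsto.const_mul _ ?_) _
    exact (Complex.continuous_ofReal.tendsto _).comp ((tendsto_sqrt_mul_evenKernel _).comp hsc)
  simp only [Complex.ofReal_one, mul_one] at h
  refine h.congr' ?_
  filter_upwards [self_mem_nhdsWithin] with ε hε
  rw [jacobiTheta_rational_add hε, Finset.mul_sum, Finset.sum_div]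
  refine Finset.sum_congr rfl fun r _ => ?_
  rw [Real.sqrt_mul (by positivity), Real.sqrt_sq hN'.le]
  have : (N : ℂ) ≠ 0 := NeZero.ne _
  push_cast
  field_simp

theorem jacobiTheta_functional_equation (τ : ℂ) :
    jacobiTheta τ = 1 / (-Complex.I * τ) ^ (1 / 2 : ℂ) * jacobiTheta (-1 / τ) := by
  simpa [jacobiTheta_eq_jacobiTheta₂] using jacobiTheta₂_functional_equation 0 τ

open Filter Topology in
theorem tendsto_sqrt_mul_jacobiTheta_inv {m : ℕ} (hm : 0 < m) :
    Tendsto (fun ε : ℝ => (Real.sqrt ε : ℂ) * jacobiTheta (1 / (2 * m) + ε * Complex.I)) (𝓝[>] 0)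
      (𝓝 (1 / (-Complex.I / (2 * m)) ^ (1 / 2 : ℂ) / (2 * m))) := by
  have hm0 : (m : ℂ) ≠ 0 := by exact_mod_cast hm.ne'
  have hmr : (0 : ℝ) < m := by exact_mod_cast hm
  set v : ℝ → ℂ := fun ε => (2 * m) ^ 2 / (1 + 2 * m * ε * Complex.I) with hv
  have hden : ∀ ε : ℝ, (1 + 2 * m * ε * Complex.I : ℂ) ≠ 0 := by
    intro ε h
    have := congrArg Complex.re h
    simp at this
  have hvne : ∀ ε, v ε ≠ 0 := fun ε => div_ne_zero (by simpa using hm0) (hden ε)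
  have hre : Tendsto (fun ε : ℝ => 1 / (-Complex.I * (1 / (2 * m) + ε * Complex.I)) ^ (1 / 2 : ℂ) *
      (1 / (v ε) ^ (1 / 2 : ℂ))) (𝓝[>] 0)
      (𝓝 (1 / (-Complex.I / (2 * m)) ^ (1 / 2 : ℂ) * (1 / (2 * m)))) := by
    have hslit : -Complex.I / (2 * m) ∈ Complex.slitPlane := by
      rw [show -Complex.I / (2 * m) = ((-1 / (2 * m) : ℝ) : ℂ) * Complex.I by push_cast; ring]
      refine Or.inr ?_
      rw [Complex.im_ofReal_mul, Complex.I_im, mul_one]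
      positivity
    have h4 : (((2 * m) ^ 2 : ℂ)) ^ (1 / 2 : ℂ) = 2 * m := by
      have := ofReal_mul_cpow_half (r := (2 * m) ^ 2) (by positivity) (one_ne_zero (α := ℂ))
      rw [Real.sqrt_sq (by positivity)] at this
      simpa using this
    refine Tendsto.mono_left (Tendsto.mul ?_ ?_) nhdsWithin_le_nhds
    · refine Tendsto.div tendsto_const_nhds ?_ ?_
      · refine Tendsto.cpow ?_ tendsto_const_nhds hslit
        refine Continuous.tendsto' (by fun_prop) _ _ ?_
        simp [div_eq_mul_inv]
      · rw [Complex.cpow_ne_zero_iff]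
        left; simp [hm0]
    · rw [← h4]
      refine Tendsto.div tendsto_const_nhds ?_ ?_
      · refine Tendsto.cpow ?_ tendsto_const_nhds ?_
        · refine Continuous.tendsto' (continuous_const.div (by fun_prop) hden) _ _ ?_
          simp
        · left; norm_cast; positivity
      · rw [h4]; simpa using hm0
  have hth : Tendsto (fun ε : ℝ => jacobiTheta (-1 / (ε * v ε * Complex.I))) (𝓝[>] 0) (𝓝 1) := by
    have him : Tendsto (fun ε : ℝ => (-1 / (ε * v ε * Complex.I)).im) (𝓝[>] 0) atTop := by
      refine (tendsto_inv_nhdsGT_zero.const_mul_atTop (r := ((2 * m : ℝ) ^ 2)⁻¹)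
        (by positivity)).congr' ?_
      filter_upwards [self_mem_nhdsWithin] with ε hε
      have h0 : (ε : ℂ) ≠ 0 := by exact_mod_cast (ne_of_gt hε)
      have : -1 / (ε * v ε * Complex.I) =
          ((-1 / (2 * m) : ℝ) : ℂ) + ((((2 * m : ℝ) ^ 2)⁻¹ * ε⁻¹ : ℝ) : ℂ) * Complex.I := by
        have := hden ε
        simp only [hv]
        push_cast
        field_simp
        linear_combination -Complex.I_sq
      rw [this, Complex.add_im, Complex.ofReal_im, Complex.im_ofReal_mul, Complex.I_im]
      ring
    have h0 := isBigO_at_im_infty_jacobiTheta_sub_one.comp_tendsto (tendsto_comap_iff.mpr him)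
    have h1 : Tendsto (fun ε : ℝ => Real.exp (-Real.pi * (-1 / (ε * v ε * Complex.I)).im)) (𝓝[>] 0)
        (𝓝 0) :=
      Real.tendsto_exp_atBot.comp (him.const_mul_atTop_of_neg (neg_neg_of_pos Real.pi_pos))
    simpa [Function.comp_def] using (h0.trans_tendsto h1).add_const 1
  have hmain := hre.mul hth
  rw [mul_one, mul_one_div] at hmain
  refine hmain.congr' ?_
  filter_upwards [self_mem_nhdsWithin] with ε hε
  have hε' : 0 < ε := hε
  have hs : (Real.sqrt ε : ℂ) ≠ 0 := by exact_mod_cast (Real.sqrt_pos.mpr hε').ne'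
  have h1 : -1 / (1 / (2 * m) + ε * Complex.I) = ε * v ε * Complex.I - 2 * m := by
    have h2 : (1 / (2 * m) + ε * Complex.I) = (1 + 2 * m * ε * Complex.I) / (2 * m) := by
      field_simp
    rw [h2]
    have := hden ε
    simp only [hv]
    field_simp
    ring
  rw [jacobiTheta_functional_equation (1 / (2 * m) + ε * Complex.I), h1,
    show (2 * m : ℂ) = 2 * (m : ℕ) from rfl, jacobiTheta_sub_two_mul_nat,
    jacobiTheta_functional_equation (ε * v ε * Complex.I),
    show -Complex.I * (ε * v ε * Complex.I) = ε * v ε by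
      linear_combination (-ε * v ε) * Complex.I_sq,
    ofReal_mul_cpow_half hε' (hvne ε)]
  field_simp

/-- The quadratic Gauss sum for a modulus divisible by four. -/
theorem sum_stdAddChar_sq_of_four_dvd {N : ℕ} [NeZero N] (h4 : 4 ∣ N) :
    ∑ r : ZMod N, ZMod.stdAddChar (r * r) = (Real.sqrt N : ℂ) * (1 + Complex.I) := by
  obtain ⟨m, rfl⟩ := h4
  have hm : 0 < m := by have := NeZero.pos (4 * m); omega
  have hm0 : (m : ℂ) ≠ 0 := by exact_mod_cast hm.ne'
  have h1 := tendsto_sqrt_mul_jacobiTheta_rational (N := 4 * m)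
  have h2 := tendsto_sqrt_mul_jacobiTheta_inv hm
  rw [show (1 / (2 * m) : ℂ) = 2 / ((4 * m : ℕ) : ℂ) by push_cast; field_simp; norm_num] at h2
  have h3 := tendsto_nhds_unique h1 h2
  have hsum : ∑ r : ZMod (4 * m), ZMod.stdAddChar (r * r) =
      ∑ r : Fin (4 * m),
        Complex.exp (2 * Real.pi * Complex.I * ((r : ℕ) ^ 2 : ℕ) / (4 * m : ℕ)) := by
    refine (Fintype.sum_equiv (ZMod.finEquiv (4 * m)).toEquiv _ _ fun r => ?_).symm
    have : (ZMod.finEquiv (4 * m)).toEquiv r = (((r : ℕ) : ℤ) : ZMod (4 * m)) := by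
      obtain ⟨k, hk⟩ : ∃ k, 4 * m = k + 1 := ⟨4 * m - 1, by omega⟩
      generalize 4 * m = M at *
      subst hk
      exact (Fin.cast_val_eq_self r).symm
    rw [this, ← Int.cast_mul, ZMod.stdAddChar_coe]
    push_cast
    ring_nf
  rw [hsum]
  have h5 : (-Complex.I / (2 * m)) ^ (1 / 2 : ℂ) =
      (Real.sqrt (1 / (2 * m)) : ℂ) * ((Real.sqrt 2 : ℂ) / 2 * (1 - Complex.I)) := by
    rw [← neg_I_cpow_half, ← ofReal_mul_cpow_half (by positivity) (by simp)]
    congr 1; push_cast; ring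
  rw [h5, div_eq_iff (NeZero.ne _)] at h3
  rw [h3]
  have e1 : Real.sqrt (4 * m : ℕ) = 2 * Real.sqrt m := by
    push_cast
    rw [Real.sqrt_mul (by norm_num), show (4 : ℝ) = 2 ^ 2 by norm_num, Real.sqrt_sq (by norm_num)]
  have e2 : Real.sqrt (1 / (2 * m)) = 1 / (Real.sqrt 2 * Real.sqrt m) := by
    rw [Real.sqrt_div (by norm_num), Real.sqrt_one, Real.sqrt_mul (by norm_num)]
  rw [e1, e2]
  have e3 : (Real.sqrt m : ℂ) ^ 2 = m := by
    norm_cast; rw [Real.sq_sqrt (by positivity)]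
  have e4 : (Real.sqrt m : ℂ) ≠ 0 := by
    intro h; rw [h] at e3; simp at e3; exact hm0 e3.symm
  have e5 : (Real.sqrt 2 : ℂ) ≠ 0 := by norm_cast; positivity
  have e6 : (1 - Complex.I) ≠ 0 := by
    intro h; have := congrArg Complex.re h; simp at this
  push_cast
  field_simp
  linear_combination 2 * Complex.I_sq

theorem four_mul_finrank_ker_sub_one {V : Type*} [AddCommGroup V] [Module ℂ V]
    [FiniteDimensional ℂ V] (T : V →ₗ[ℂ] V) (hT : T ^ 4 = 1) :
    4 * (Module.finrank ℂ (LinearMap.ker (T - 1)) : ℂ) =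
      Module.finrank ℂ V + LinearMap.trace ℂ V T + LinearMap.trace ℂ V (T ^ 2) +
        LinearMap.trace ℂ V (T ^ 3) := by
  have hP : LinearMap.IsProj (LinearMap.ker (T - 1)) ((4 : ℂ)⁻¹ • (1 + T + T ^ 2 + T ^ 3)) := by
    refine ⟨fun x => ?_, fun x hx => ?_⟩
    · have h : (T - 1) * (1 + T + T ^ 2 + T ^ 3) = 0 := by
        have : (T - 1) * (1 + T + T ^ 2 + T ^ 3) = T ^ 4 - 1 := by noncomm_ring
        rw [this, hT, sub_self]
      have h' := LinearMap.congr_fun h x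
      rw [LinearMap.mem_ker, LinearMap.smul_apply, map_smul]
      rw [Module.End.mul_apply] at h'
      rw [h']; simp
    · have hx' : T x = x := by simpa [sub_eq_zero] using hx
      simp only [LinearMap.smul_apply, LinearMap.add_apply, Module.End.one_apply, pow_succ,
        pow_zero, one_mul, Module.End.mul_apply, hx']
      module
  rw [← hP.trace]
  simp only [map_smul, map_add, LinearMap.trace_one, smul_eq_mul]
  ring

theorem trace_pi_eq_sum {ι : Type*} [Fintype ι] [DecidableEq ι] (T : (ι → ℂ) →ₗ[ℂ] (ι → ℂ)) :
    LinearMap.trace ℂ (ι → ℂ) T = ∑ i, T (Pi.single i 1) i := by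
  rw [LinearMap.trace_eq_matrix_trace ℂ (Pi.basisFun ℂ ι), Matrix.trace]
  simp

section DiscreteFourier

variable {N : ℕ} [NeZero N]

/-- A scalar multiple of the unitary discrete Fourier transform. -/
def scaledDFT (N : ℕ) [NeZero N] (κ : ℂ) : (ZMod N → ℂ) →ₗ[ℂ] (ZMod N → ℂ) :=
  (κ * (Real.sqrt N : ℂ)⁻¹) • (ZMod.dft : (ZMod N → ℂ) ≃ₗ[ℂ] (ZMod N → ℂ)).toLinearMap

theorem scaledDFT_apply (κ : ℂ) (c : ZMod N → ℂ) (k : ZMod N) :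
    scaledDFT N κ c k = κ * (Real.sqrt N : ℂ)⁻¹ * ZMod.dft c k := rfl

theorem inv_sqrt_natCast_sq : (Real.sqrt N : ℂ)⁻¹ ^ 2 * N = 1 := by
  have : (Real.sqrt N : ℂ) ^ 2 = N := by norm_cast; rw [Real.sq_sqrt (by positivity)]
  rw [inv_pow, this, inv_mul_cancel₀ (NeZero.ne _)]

theorem scaledDFT_sq_apply (κ : ℂ) (c : ZMod N → ℂ) :
    scaledDFT N κ (scaledDFT N κ c) = fun k => κ ^ 2 * c (-k) := by
  have h : scaledDFT N κ c = (κ * (Real.sqrt N : ℂ)⁻¹) • ZMod.dft c := rfl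
  ext k
  rw [scaledDFT_apply, h, map_smul, ZMod.dft_dft, Pi.smul_apply, smul_eq_mul, smul_eq_mul]
  linear_combination κ ^ 2 * c (-k) * inv_sqrt_natCast_sq (N := N)

theorem dft_single (j k : ZMod N) :
    ZMod.dft (Pi.single j 1 : ZMod N → ℂ) k = ZMod.stdAddChar (-(j * k)) := by
  rw [ZMod.dft_apply, Finset.sum_eq_single j] <;> simp +contextual

theorem trace_scaledDFT (κ : ℂ) :
    LinearMap.trace ℂ _ (scaledDFT N κ) =
      κ * (Real.sqrt N : ℂ)⁻¹ * ∑ r : ZMod N, ZMod.stdAddChar (-(r * r)) := by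
  rw [trace_pi_eq_sum, Finset.mul_sum]
  simp [scaledDFT_apply, dft_single]

theorem trace_scaledDFT_pow_two (hN : Even N) (κ : ℂ) :
    LinearMap.trace ℂ _ (scaledDFT N κ ^ 2) = 2 * κ ^ 2 := by
  have hN0 : N ≠ 0 := NeZero.ne N
  obtain ⟨M, hM⟩ := hN
  have hMN : M < N := by omega
  have hval : (M : ZMod N).val = M := ZMod.val_cast_of_lt hMN
  have hM0 : (0 : ZMod N) ≠ M := by
    intro h; rw [← h] at hval; simp at hval; omega
  have hiff : ∀ i : ZMod N, -i = i ↔ i ∈ ({0, (M : ZMod N)} : Finset (ZMod N)) := by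
    intro i
    rw [ZMod.neg_eq_self_iff, Finset.mem_insert, Finset.mem_singleton]
    refine or_congr_right ⟨fun h => ?_, fun h => ?_⟩
    · rw [← ZMod.natCast_zmod_val i]; congr 1; omega
    · rw [h, hval]; omega
  rw [trace_pi_eq_sum]
  have : ∀ i : ZMod N, (scaledDFT N κ ^ 2) (Pi.single i 1) i =
      if i ∈ ({0, (M : ZMod N)} : Finset (ZMod N)) then κ ^ 2 else 0 := by
    intro i
    rw [pow_two, Module.End.mul_apply, scaledDFT_sq_apply]
    simp only [Pi.single_apply, hiff, mul_ite, mul_one, mul_zero]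
  simp_rw [this]
  rw [Finset.sum_ite_mem, Finset.univ_inter, Finset.sum_pair hM0]
  ring

theorem trace_scaledDFT_pow_three (κ : ℂ) :
    LinearMap.trace ℂ _ (scaledDFT N κ ^ 3) =
      κ ^ 3 * (Real.sqrt N : ℂ)⁻¹ * ∑ r : ZMod N, ZMod.stdAddChar (r * r) := by
  rw [trace_pi_eq_sum, Finset.mul_sum]
  refine Finset.sum_congr rfl fun i _ => ?_
  rw [pow_succ, pow_two, Module.End.mul_apply, Module.End.mul_apply, scaledDFT_sq_apply]
  simp only [scaledDFT_apply, dft_single, mul_neg, neg_neg]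
  ring

theorem scaledDFT_pow_four {κ : ℂ} (hκ : κ ^ 4 = 1) : scaledDFT N κ ^ 4 = 1 := by
  ext1 i
  ext k
  simp only [LinearMap.comp_apply, pow_succ, pow_zero, one_mul, Module.End.mul_apply,
    scaledDFT_sq_apply, Module.End.one_apply, neg_neg]
  linear_combination (LinearMap.single ℂ (fun _ : ZMod N => ℂ) i 1 k) * hκ

theorem sum_stdAddChar_neg_sq :
    ∑ r : ZMod N, ZMod.stdAddChar (-(r * r)) =
      (starRingEnd ℂ) (∑ r : ZMod N, ZMod.stdAddChar (r * r)) := by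
  rw [map_sum]
  exact Finset.sum_congr rfl fun r _ => AddChar.map_neg_eq_conj _ _

/-- The quadratic Gauss sum vanishes for a modulus congruent to two modulo four. -/
theorem sum_stdAddChar_sq_of_mod_four_eq_two (hN : N % 4 = 2) :
    ∑ r : ZMod N, ZMod.stdAddChar (r * r) = (0 : ℂ) := by
  obtain ⟨m, M, hM, rfl⟩ : ∃ m M, M = 2 * m + 1 ∧ N = 2 * M :=
    ⟨N / 4, 2 * (N / 4) + 1, rfl, by omega⟩
  have h := Fintype.sum_equiv (Equiv.addRight (M : ZMod (2 * M)))
    (fun r => (ZMod.stdAddChar ((r + (M : ZMod (2 * M))) * (r + (M : ZMod (2 * M)))) : ℂ))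
    (fun r => ZMod.stdAddChar (r * r))
    fun r => rfl
  have h1 : ZMod.stdAddChar ((M : ZMod (2 * M)) * (M : ZMod (2 * M))) = (-1 : ℂ) := by
    have h2 := ZMod.stdAddChar_coe (N := 2 * M) ((M : ℤ) * M)
    push_cast at h2
    have hM0 : (M : ℂ) ≠ 0 := by exact_mod_cast (by omega : M ≠ 0)
    rw [h2, show 2 * Real.pi * Complex.I * (M * M : ℂ) / (2 * M) =
      Real.pi * Complex.I + m * (2 * Real.pi * Complex.I) by
        field_simp; rw [hM]; push_cast; ring, Complex.exp_add, Complex.exp_pi_mul_I,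
      Complex.exp_nat_mul_two_pi_mul_I, mul_one]
  have h2 : ∀ r : ZMod (2 * M),
      (ZMod.stdAddChar ((r + (M : ZMod (2 * M))) * (r + (M : ZMod (2 * M)))) : ℂ) =
      -ZMod.stdAddChar (r * r) := by
    intro r
    have h0 : (2 * M : ZMod (2 * M)) = 0 := by exact_mod_cast ZMod.natCast_self (2 * M)
    rw [show (r + (M : ZMod (2 * M))) * (r + (M : ZMod (2 * M))) =
      r * r + (M : ZMod (2 * M)) * M by linear_combination r * h0,
      AddChar.map_add_eq_mul, h1]
    ring
  simp_rw [h2, Finset.sum_neg_distrib] at h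
  linear_combination -h / 2

theorem four_mul_finrank_ker_scaledDFT (hN : Even N) {κ : ℂ} (hκ : κ ^ 4 = 1) :
    4 * (Module.finrank ℂ (LinearMap.ker (scaledDFT N κ - 1)) : ℂ) =
      N + 2 * κ ^ 2 + if 4 ∣ N then κ * (1 - Complex.I) + κ ^ 3 * (1 + Complex.I) else 0 := by
  rw [four_mul_finrank_ker_sub_one _ (scaledDFT_pow_four hκ), trace_scaledDFT,
    trace_scaledDFT_pow_two hN, trace_scaledDFT_pow_three, sum_stdAddChar_neg_sq]
  have hs : (Real.sqrt N : ℂ)⁻¹ * (Real.sqrt N : ℂ) = 1 :=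
    inv_mul_cancel₀ (by exact_mod_cast (Real.sqrt_pos.mpr (by exact_mod_cast NeZero.pos N)).ne')
  simp only [Module.finrank_fintype_fun_eq_card, ZMod.card]
  split_ifs with h
  · rw [sum_stdAddChar_sq_of_four_dvd h]
    simp only [map_mul, map_add, map_one, Complex.conj_ofReal, Complex.conj_I]
    linear_combination (κ * (1 - Complex.I) + κ ^ 3 * (1 + Complex.I)) * hs
  · rw [sum_stdAddChar_sq_of_mod_four_eq_two (by obtain ⟨M, hM⟩ := hN; omega)]
    simp

end DiscreteFourier

section HermiteFunctions

open Polynomial Filter Asymptotics FourierTransform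

/-- A polynomial times the standard Gaussian. -/
def polyGauss (P : ℂ[X]) (x : ℝ) : ℂ := P.eval (x : ℂ) * Complex.exp (-Real.pi * x ^ 2)

theorem continuous_polyGauss (P : ℂ[X]) : Continuous (polyGauss P) :=
  (P.continuous.comp Complex.continuous_ofReal).mul (by fun_prop)

theorem polyGauss_sub (P Q : ℂ[X]) (x : ℝ) :
    polyGauss (P - Q) x = polyGauss P x - polyGauss Q x := by
  simp [polyGauss, sub_mul]

theorem polyGauss_C_mul (c : ℂ) (P : ℂ[X]) (x : ℝ) :
    polyGauss (C c * P) x = c * polyGauss P x := by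
  simp [polyGauss, mul_assoc]

theorem polyGauss_X_mul (P : ℂ[X]) (x : ℝ) : polyGauss (X * P) x = x * polyGauss P x := by
  simp [polyGauss, mul_assoc]

theorem hasDerivAt_polyGauss (P : ℂ[X]) (x : ℝ) :
    HasDerivAt (polyGauss P) (polyGauss (derivative P - C (2 * Real.pi : ℂ) * (X * P)) x) x := by
  have h1 : HasDerivAt (fun z : ℂ => P.eval z * Complex.exp (-Real.pi * z ^ 2))
      ((derivative P).eval (x : ℂ) * Complex.exp (-Real.pi * x ^ 2) +
        P.eval (x : ℂ) * (Complex.exp (-Real.pi * x ^ 2) * (-Real.pi * (2 * x)))) (x : ℂ) := by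
    refine (P.hasDerivAt _).mul (HasDerivAt.cexp ?_)
    simpa using (hasDerivAt_pow 2 (x : ℂ)).const_mul (-Real.pi : ℂ)
  refine h1.comp_ofReal.congr_deriv ?_
  simp [polyGauss]
  ring

theorem integrable_polyGauss (P : ℂ[X]) : MeasureTheory.Integrable (polyGauss P) := by
  induction P using Polynomial.induction_on' with
  | add P Q hP hQ =>
    refine (hP.add hQ).congr (MeasureTheory.ae_of_all _ fun x => ?_)
    simp [polyGauss, add_mul]
  | monomial n c =>
    have h := ((integrable_rpow_mul_exp_neg_mul_sq Real.pi_pos (s := n)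
      (by have : (0 : ℝ) ≤ n := n.cast_nonneg
          linarith)).ofReal (𝕜 := ℂ)).const_mul c
    refine h.congr (MeasureTheory.ae_of_all _ fun x => ?_)
    simp [polyGauss, mul_assoc]

theorem polynomial_mul_cexp_isBigO (P : ℂ[X]) {a : ℂ} (ha : a.re < 0) (b : ℂ) (s : ℝ) :
    (fun x : ℝ => P.eval (x : ℂ) * Complex.exp (a * x ^ 2 + b * x)) =O[cocompact ℝ]
      fun x => |x| ^ s := by
  induction P using Polynomial.induction_on' with
  | add P Q hP hQ =>
    refine (hP.add hQ).congr_left fun x => ?_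
    simp [add_mul]
  | monomial n c =>
    have h1 := (cexp_neg_quadratic_isLittleO_abs_rpow_cocompact ha b (s - n)).isBigO
    have h2 : (fun x : ℝ => c * (x : ℂ) ^ n) =O[cocompact ℝ] fun x : ℝ => |x| ^ (n : ℝ) := by
      refine IsBigO.of_bound ‖c‖ (Eventually.of_forall fun x => ?_)
      simp
    refine ((h2.mul h1).congr_left fun x => by simp).trans ?_
    refine EventuallyEq.isBigO ?_
    have h0 : ∀ᶠ x : ℝ in cocompact ℝ, x ≠ 0 := by
      simpa using (isCompact_singleton (x := (0 : ℝ))).compl_mem_cocompact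
    filter_upwards [h0] with x hx
    rw [← Real.rpow_add (abs_pos.mpr hx)]
    ring_nf

theorem polyGauss_affine_isBigO (P : ℂ[X]) {A : ℝ} (hA : A ≠ 0) (B : ℝ) (b : ℂ) (s : ℝ) :
    (fun x : ℝ => polyGauss P (A * x + B) * Complex.exp (b * x)) =O[cocompact ℝ]
      fun x => |x| ^ s := by
  have h := (polynomial_mul_cexp_isBigO (P.comp (C (A : ℂ) * X + C (B : ℂ)))
    (a := ((-(Real.pi * A ^ 2) : ℝ) : ℂ))
        (by rw [Complex.ofReal_re]; exact neg_neg_of_pos (by positivity))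
    (b - 2 * Real.pi * A * B) s).const_mul_left (Complex.exp (-Real.pi * B ^ 2))
  refine h.congr_left fun x => ?_
  simp only [polyGauss, eval_comp, eval_add, eval_mul, eval_C, eval_X]
  push_cast
  rw [mul_left_comm, ← Complex.exp_add, mul_assoc (eval _ P), ← Complex.exp_add]
  congr 2
  ring

theorem summable_norm_polyGauss_affine (P : ℂ[X]) {A : ℝ} (hA : A ≠ 0) (B : ℝ) (b : ℂ) :
    Summable fun t : ℤ => ‖polyGauss P (A * t + B) * Complex.exp (b * t)‖ := by
  have h := (polyGauss_affine_isBigO P hA B b (-2)).comp_tendsto Int.tendsto_coe_cofinite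
  refine summable_of_isBigO (Real.summable_abs_int_rpow one_lt_two) ?_
  simpa [Function.comp_def] using h.norm_left

theorem fourier_polyGauss_affine (P : ℂ[X]) {κ : ℂ}
    (hκ : 𝓕 (polyGauss P) = fun x => κ * polyGauss P x)
    {A : ℝ} (hA : 0 < A) (B D ξ : ℝ) :
    𝓕 (fun x : ℝ => polyGauss P (A * x + B) * Complex.exp (2 * Real.pi * Complex.I * D * x)) ξ =
      κ / A * (polyGauss P ((ξ - D) / A) *
        Complex.exp (2 * Real.pi * Complex.I * (B / A) * (ξ - D))) := by
  have hA' : (A : ℂ) ≠ 0 := by exact_mod_cast hA.ne'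
  have h1 := congrFun hκ ((ξ - D) / A)
  rw [Real.fourier_real_eq_integral_exp_smul] at h1 ⊢
  simp only [smul_eq_mul] at h1 ⊢
  set G : ℝ → ℂ := fun v => Complex.exp (((-2 * Real.pi * v * ((ξ - D) / A) : ℝ) : ℂ) * Complex.I) *
    polyGauss P v with hG
  have h2 := MeasureTheory.Measure.integral_comp_mul_left (fun y => G (y + B)) A
  rw [MeasureTheory.integral_add_right_eq_self G B, h1, abs_of_pos (inv_pos.mpr hA)] at h2
  have h3 : ∀ x : ℝ, Complex.exp (((-2 * Real.pi * x * ξ : ℝ) : ℂ) * Complex.I) *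
      (polyGauss P (A * x + B) * Complex.exp (2 * Real.pi * Complex.I * D * x)) =
      Complex.exp (2 * Real.pi * Complex.I * (B / A) * (ξ - D)) * G (A * x + B) := by
    intro x
    rw [hG, mul_left_comm, ← Complex.exp_add, mul_comm (polyGauss P _), ← mul_assoc,
      ← Complex.exp_add]
    congr 2
    push_cast
    field_simp
    ring
  simp_rw [h3]
  rw [MeasureTheory.integral_const_mul, h2, Complex.real_smul]
  push_cast
  ring

/-- Poisson summation for a polynomial Gaussian that is an eigenfunction of the
Fourier transform. -/
theorem tsum_polyGauss_affine (P : ℂ[X]) {κ : ℂ} (hκ : 𝓕 (polyGauss P) = fun x => κ * polyGauss P x)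
    {A : ℝ} (hA : 0 < A) (B D : ℝ) :
    ∑' k : ℤ, polyGauss P (A * k + B) * Complex.exp (2 * Real.pi * Complex.I * D * k) =
      κ / A * ∑' j : ℤ, polyGauss P ((j - D) / A) *
        Complex.exp (2 * Real.pi * Complex.I * (B / A) * (j - D)) := by
  have hF := fun ξ => fourier_polyGauss_affine P hκ hA B D ξ
  have h := Real.tsum_eq_tsum_fourier_of_rpow_decay
    (f := fun x : ℝ => polyGauss P (A * x + B) * Complex.exp (2 * Real.pi * Complex.I * D * x))
    (((continuous_polyGauss P).comp (by fun_prop)).mul (by fun_prop)) one_lt_two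
    (polyGauss_affine_isBigO P hA.ne' B _ _) ?_ 0
  · simp only [zero_add, hF] at h
    simpa [tsum_mul_left] using h
  · have h3 := (polyGauss_affine_isBigO P (inv_ne_zero hA.ne') (-(D / A))
      (2 * Real.pi * Complex.I * (B / A)) (-2)).const_mul_left
      (κ / A * Complex.exp (-(2 * Real.pi * Complex.I * (B / A) * D)))
    refine h3.congr_left fun ξ => ?_
    rw [hF, mul_assoc, mul_left_comm (Complex.exp _), ← Complex.exp_add]
    ring_nf

/-- The Hermite polynomial in the variable `√(2π) x`. -/
def scaledHermite (lam : ℕ) : ℂ[X] :=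
  ((physHermite lam).map (algebraMap ℝ ℂ)).comp (C (Real.sqrt (2 * Real.pi) : ℂ) * X)

theorem scaledHermite_succ (lam : ℕ) :
    scaledHermite (lam + 1) = C (Real.sqrt (2 * Real.pi) : ℂ) * (X * scaledHermite lam) -
      C ((Real.sqrt (2 * Real.pi) : ℂ)⁻¹) * (derivative (scaledHermite lam) -
        C (2 * Real.pi : ℂ) * (X * scaledHermite lam)) := by
  have hs : (Real.sqrt (2 * Real.pi) : ℂ) ≠ 0 := by exact_mod_cast (by positivity)
  have hs2 : (2 * Real.pi : ℂ) = (Real.sqrt (2 * Real.pi) : ℂ) * (Real.sqrt (2 * Real.pi) : ℂ) := by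
    norm_cast; rw [Real.mul_self_sqrt (by positivity)]
  have hC : C ((Real.sqrt (2 * Real.pi) : ℂ)⁻¹) * C (Real.sqrt (2 * Real.pi) : ℂ) = 1 := by
    rw [← C_mul, inv_mul_cancel₀ hs, C_1]
  have h1 : derivative (scaledHermite lam) = C (Real.sqrt (2 * Real.pi) : ℂ) *
      ((derivative (physHermite lam)).map (algebraMap ℝ ℂ)).comp
        (C (Real.sqrt (2 * Real.pi) : ℂ) * X) := by
    rw [scaledHermite, derivative_comp, derivative_map]; simp
  have h2 : scaledHermite (lam + 1) = 2 * C (Real.sqrt (2 * Real.pi) : ℂ) * X * scaledHermite lam -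
      ((derivative (physHermite lam)).map (algebraMap ℝ ℂ)).comp
        (C (Real.sqrt (2 * Real.pi) : ℂ) * X) := by
    simp only [scaledHermite, physHermite, Polynomial.map_sub, Polynomial.map_mul, map_X,
      Polynomial.map_ofNat, sub_comp, mul_comp, X_comp, ofNat_comp]
    ring
  rw [h1, h2, hs2, C_mul]
  linear_combination (((derivative (physHermite lam)).map (algebraMap ℝ ℂ)).comp
    (C (Real.sqrt (2 * Real.pi) : ℂ) * X) -
    C (Real.sqrt (2 * Real.pi) : ℂ) * X * scaledHermite lam) * hC

theorem fourier_polyGauss_C_mul (c : ℂ) (P : ℂ[X]) (w : ℝ) :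
    𝓕 (polyGauss (C c * P)) w = c * 𝓕 (polyGauss P) w := by
  simp only [Real.fourier_real_eq_integral_exp_smul, polyGauss_C_mul, smul_eq_mul]
  rw [← MeasureTheory.integral_const_mul]
  simp only [mul_left_comm]

theorem fourier_polyGauss_sub (P Q : ℂ[X]) (w : ℝ) :
    𝓕 (polyGauss (P - Q)) w = 𝓕 (polyGauss P) w - 𝓕 (polyGauss Q) w := by
  have h (P : ℂ[X]) := (Real.fourierIntegral_convergent_iff w).mpr (integrable_polyGauss P)
  simp only [Real.fourier_real_eq, polyGauss_sub, smul_sub]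
  exact MeasureTheory.integral_sub (by simpa [mul_comm] using h P) (by simpa [mul_comm] using h Q)

/-- Hermite functions are eigenfunctions of the Fourier transform. -/
theorem fourier_polyGauss_scaledHermite (lam : ℕ) :
    𝓕 (polyGauss (scaledHermite lam)) =
      fun x => (-Complex.I) ^ lam * polyGauss (scaledHermite lam) x := by
  induction lam with
  | zero =>
    have := fourier_gaussian_pi (b := 1) (by simp)
    have h0 : polyGauss (scaledHermite 0) = fun x : ℝ => Complex.exp (-Real.pi * 1 * x ^ 2) := by
      ext x; simp [polyGauss, scaledHermite, physHermite]
    rw [h0, this]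
    simp
  | succ lam ih =>
    set P := scaledHermite lam
    set Q := derivative P - C (2 * Real.pi : ℂ) * (X * P)
    have hQ : deriv (polyGauss P) = polyGauss Q := funext fun x => (hasDerivAt_polyGauss P x).deriv
    have hX : (fun x : ℝ => x • polyGauss P x) = polyGauss (X * P) := by
      ext x; rw [polyGauss_X_mul]; simp
    have h1 := Real.fourier_deriv (integrable_polyGauss P)
      (fun x => (hasDerivAt_polyGauss P x).differentiableAt) (hQ ▸ integrable_polyGauss Q)
    rw [hQ, ih] at h1
    have h2 : 𝓕 (polyGauss (C (-2 * Real.pi * Complex.I) * (X * P))) =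
        fun w => (-Complex.I) ^ lam * polyGauss Q w := by
      ext w
      have h3 := Real.hasDerivAt_fourier (integrable_polyGauss P)
        (by rw [hX]; exact integrable_polyGauss _) w
      rw [ih] at h3
      have h4 := h3.unique ((hasDerivAt_polyGauss P w).const_mul ((-Complex.I) ^ lam))
      rw [← h4]
      refine congrFun (congrArg _ (funext fun x => ?_)) w
      rw [polyGauss_C_mul, polyGauss_X_mul, smul_eq_mul]
      ring
    ext w
    have e1 := congrFun h1 w
    have e2 := congrFun h2 w
    rw [fourier_polyGauss_C_mul] at e2
    rw [scaledHermite_succ, fourier_polyGauss_sub, fourier_polyGauss_C_mul, fourier_polyGauss_C_mul,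
      e1, polyGauss_sub, polyGauss_C_mul, polyGauss_C_mul, polyGauss_X_mul]
    have hs : (Real.sqrt (2 * Real.pi) : ℂ) ≠ 0 := by exact_mod_cast (by positivity)
    have hs2 : (Real.sqrt (2 * Real.pi) : ℂ) ^ 2 = 2 * Real.pi := by
      norm_cast; rw [Real.sq_sqrt (by positivity)]
    have hpi : (Real.pi : ℂ) ≠ 0 := by exact_mod_cast Real.pi_ne_zero
    have e3 : 𝓕 (polyGauss (X * P)) w =
        (-Complex.I) ^ lam * polyGauss Q w * (Complex.I / (2 * Real.pi)) := by
      rw [← e2]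
      field_simp
      linear_combination 𝓕 (polyGauss (X * P)) w * Complex.I_sq
    rw [e3, smul_eq_mul, ← hs2]
    field_simp
    rw [hs2]
    ring

theorem physHermite_comp_neg_X (lam : ℕ) :
    (physHermite lam).comp (-X) = (-1) ^ lam * physHermite lam := by
  induction lam with
  | zero => simp [physHermite]
  | succ k ih =>
    have h := congrArg derivative ih
    rw [derivative_comp, derivative_mul, show ((-1 : ℝ[X]) ^ k) = C ((-1) ^ k) by simp,
      derivative_C] at h
    simp only [derivative_neg, derivative_X, zero_mul, zero_add, C_pow, C_neg, C_1] at h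
    rw [physHermite, sub_comp, mul_comp, mul_comp, X_comp, ofNat_comp, ih]
    linear_combination h

theorem polyGauss_scaledHermite_neg (lam : ℕ) (x : ℝ) :
    polyGauss (scaledHermite lam) (-x) = (-1) ^ lam * polyGauss (scaledHermite lam) x := by
  have h := congrArg (fun p : ℝ[X] => (p.map (algebraMap ℝ ℂ)).eval
    ((Real.sqrt (2 * Real.pi) : ℂ) * x)) (physHermite_comp_neg_X lam)
  simp only [Polynomial.map_comp, Polynomial.map_neg, map_X, eval_comp, eval_neg, eval_X,
    Polynomial.map_mul, Polynomial.map_pow, Polynomial.map_one, eval_mul, eval_pow, eval_one] at h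
  simp only [polyGauss, scaledHermite, eval_comp, eval_mul, eval_C, eval_X]
  push_cast
  rw [mul_neg, h, neg_sq, mul_assoc]

theorem coeff_physHermite (lam : ℕ) :
    (physHermite lam).coeff lam = 2 ^ lam ∧ ∀ k, lam < k → (physHermite lam).coeff k = 0 := by
  induction lam with
  | zero => exact ⟨by simp [physHermite], fun k hk => by simp [physHermite, coeff_one, hk.ne']⟩
  | succ n ih =>
    have h (k : ℕ) : (physHermite (n + 1)).coeff (k + 1) =
        2 * (physHermite n).coeff k - (physHermite n).coeff (k + 2) * (k + 2) := by
      rw [physHermite, coeff_sub, coeff_derivative, mul_assoc, coeff_ofNat_mul, coeff_X_mul]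
      push_cast
      ring
    refine ⟨by rw [h, ih.1, ih.2 (n + 2) (by omega)]; ring, fun k hk => ?_⟩
    obtain ⟨j, rfl⟩ : ∃ j, k = j + 1 := ⟨k - 1, by omega⟩
    rw [h, ih.2 j (by omega), ih.2 (j + 2) (by omega)]
    ring

theorem polyGauss_scaledHermite_mul (lam : ℕ) (x : ℝ) :
    polyGauss (scaledHermite lam) x =
      (((physHermite lam).eval (Real.sqrt (2 * Real.pi) * x) *
        Real.exp (-Real.pi * x ^ 2) : ℝ) : ℂ) := by
  have h : ((physHermite lam).map (algebraMap ℝ ℂ)).eval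
      ((Real.sqrt (2 * Real.pi) * x : ℝ) : ℂ) =
      ((physHermite lam).eval (Real.sqrt (2 * Real.pi) * x) : ℝ) := by
    rw [eval_map]; exact (eval₂_at_apply _ _)
  simp only [polyGauss, scaledHermite, eval_comp, eval_mul, eval_C, eval_X]
  push_cast at h ⊢
  rw [h]

theorem exists_polyGauss_scaledHermite_ne_zero (lam : ℕ) :
    ∃ x : ℝ, polyGauss (scaledHermite lam) x ≠ 0 := by
  by_contra! h
  have h0 : physHermite lam = 0 := by
    refine Polynomial.funext fun y => ?_
    have := h (y / Real.sqrt (2 * Real.pi))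
    rw [polyGauss_scaledHermite_mul, mul_div_cancel₀ _ (by positivity)] at this
    simpa [(Real.exp_pos _).ne'] using this
  have := (coeff_physHermite lam).1
  rw [h0, coeff_zero] at this
  exact (pow_ne_zero lam two_ne_zero) this.symm

end HermiteFunctions

theorem eq_zero_of_tsum_mul_fourier_eq_zero {f : ℤ → ℂ} (hf : Summable fun t => ‖f t‖)
    (h : ∀ x : UnitAddCircle, ∑' t, f t * fourier t x = 0) (m : ℤ) : f m = 0 := by
  have hs : Summable fun t : ℤ => f t • (fourier t : C(UnitAddCircle, ℂ)) :=
    Summable.of_norm (by simpa [norm_smul, fourier_norm] using hf)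
  have h0 : ∑' t : ℤ, f t • (fourier t : C(UnitAddCircle, ℂ)) = 0 := by
    ext x
    rw [← ContinuousMap.tsum_apply hs x]
    simpa using h x
  have h1 := ((hs.hasSum.mapL (ContinuousMap.toLp (E := ℂ) 2 AddCircle.haarAddCircle ℂ)).mapL
    (innerSL ℂ (fourierLp 2 m)))
  have ho := orthonormal_iff_ite.mp (orthonormal_fourier (T := 1)) m
  have h2 : (fun t : ℤ => innerSL ℂ (fourierLp 2 m)
      (ContinuousMap.toLp (E := ℂ) 2 AddCircle.haarAddCircle ℂ
        (f t • (fourier t : C(UnitAddCircle, ℂ))))) = fun t => if t = m then f m else 0 := by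
    ext t
    rw [map_smul, map_smul, innerSL_apply_apply]
    have h3 := ho t
    simp only [fourierLp] at h3 ⊢
    rw [h3]
    rcases eq_or_ne t m with rfl | htm
    · simp
    · simp [htm, htm.symm]
  rw [h2, h0, map_zero, map_zero] at h1
  exact (hasSum_ite_eq m (f m)).unique h1

section WeilTheta

open Real Complex

theorem sign_mul_sign_self {n : ℤ} (hn : n ≠ 0) : n.sign * n.sign = 1 := by
  rcases hn.lt_or_gt with h | h
  · simp [Int.sign_eq_neg_one_of_neg h]
  · simp [Int.sign_eq_one_of_pos h]

/-- The summands of `weilTheta`. -/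
def thetaTerm (N l : ℕ) (n : ℤ) (lam : ℕ) (x : H3) (t : ℤ) : ℂ :=
  polyGauss (scaledHermite lam) ((√N)⁻¹ * t + √|(n : ℝ)| * x.1) *
    cexp (2 * π * I * (n.sign / √(2 * l) * x.2.1 : ℝ) * t)

theorem summable_norm_mul_thetaTerm (N : ℕ) [NeZero N] (l : ℕ) (n : ℤ) (lam : ℕ) (x : H3)
    (c : ZMod N → ℂ) : Summable fun t : ℤ => ‖c t * thetaTerm N l n lam x t‖ := by
  obtain ⟨M, hM⟩ := (Set.finite_range fun k => ‖c k‖).bddAbove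
  refine Summable.of_nonneg_of_le (fun t => norm_nonneg _) (fun t => ?_)
    ((summable_norm_polyGauss_affine (scaledHermite lam) (A := (√N)⁻¹)
      (inv_ne_zero (by simpa using NeZero.ne N)) (√|(n : ℝ)| * x.1)
      (2 * π * I * (n.sign / √(2 * l) * x.2.1 : ℝ))).mul_left M)
  rw [norm_mul]
  exact mul_le_mul_of_nonneg_right (hM ⟨_, rfl⟩) (norm_nonneg _)

/-- The theta series on the Heisenberg group attached to a weight on the residues modulo `N`. -/
def weilTheta (N : ℕ) [NeZero N] (l : ℕ) (n : ℤ) (lam : ℕ) : (ZMod N → ℂ) →ₗ[ℂ] (H3 → ℂ) where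
  toFun c x := cexp (2 * π * I * n * x.2.2) * ∑' t : ℤ, c t * thetaTerm N l n lam x t
  map_add' c d := by
    ext x
    simp only [Pi.add_apply, add_mul]
    rw [(summable_norm_mul_thetaTerm N l n lam x c).of_norm.tsum_add
      (summable_norm_mul_thetaTerm N l n lam x d).of_norm, mul_add]
  map_smul' a c := by
    ext x
    simp only [Pi.smul_apply, smul_eq_mul, mul_assoc, tsum_mul_left, RingHom.id_apply]
    ring

theorem weilTheta_apply (N : ℕ) [NeZero N] (l : ℕ) (n : ℤ) (lam : ℕ) (c : ZMod N → ℂ) (x : H3) :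
    weilTheta N l n lam c x =
      cexp (2 * π * I * n * x.2.2) * ∑' t : ℤ, c t * thetaTerm N l n lam x t := rfl

theorem weilTheta_injective (N : ℕ) [NeZero N] {l : ℕ} (hl : 0 < l) {n : ℤ} (hn : n ≠ 0)
    (lam : ℕ) : Function.Injective (weilTheta N l n lam) := by
  refine (injective_iff_map_eq_zero _).mpr fun c hc => funext fun k => ?_
  obtain ⟨y, hy⟩ := exists_polyGauss_scaledHermite_ne_zero lam
  obtain ⟨m, rfl⟩ := ZMod.intCast_surjective k
  have hr : √|(n : ℝ)| ≠ 0 := by simpa using hn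
  have hl' : √(2 * l) ≠ 0 := by positivity
  have hσ : (n.sign : ℝ) * n.sign = 1 := by exact_mod_cast sign_mul_sign_self hn
  set p : ℝ := (y - (√N)⁻¹ * m) / √|(n : ℝ)| with hp
  have key := eq_zero_of_tsum_mul_fourier_eq_zero
    (f := fun t => c t * polyGauss (scaledHermite lam) ((√N)⁻¹ * t + √|(n : ℝ)| * p))
    (by simpa [thetaTerm] using summable_norm_mul_thetaTerm N l n lam (p, 0, 0) c) (fun x => ?_) m
  · have h1 : (√N)⁻¹ * m + √|(n : ℝ)| * p = y := by rw [hp]; field_simp; ring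
    simpa [h1, hy] using key
  · induction x using QuotientAddGroup.induction_on with | H v => ?_
    have := congrFun hc (p, n.sign * √(2 * l) * v, 0)
    rw [weilTheta_apply] at this
    simp only [Complex.ofReal_zero, mul_zero, Complex.exp_zero, one_mul, Pi.zero_apply] at this
    rw [← this]
    refine tsum_congr fun t => ?_
    rw [thetaTerm, ← mul_assoc]
    congr 1
    erw [fourier_coe_apply]
    rw [show (n.sign / √(2 * l) * (n.sign * √(2 * l) * v) : ℝ) = v by
      field_simp; linear_combination v * hσ]
    congr 1
    push_cast
    ring

theorem weilTheta_single (N : ℕ) [NeZero N] (l : ℕ) (n : ℤ) (lam : ℕ) (m : ℤ) (x : H3) :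
    weilTheta N l n lam (Pi.single (m : ZMod N) 1) x =
      cexp (2 * π * I * n * x.2.2) * ∑' k : ℤ, thetaTerm N l n lam x (N * k + m) := by
  have hinj : Function.Injective fun k : ℤ => (N : ℤ) * k + m := fun a b h => by
    simpa [NeZero.ne N] using h
  rw [weilTheta_apply, ← hinj.tsum_eq]
  · simp
  · intro t ht
    have h1 : (t : ZMod N) = m := by
      by_contra h
      simp [Pi.single_apply, h] at ht
    obtain ⟨k, hk⟩ := (ZMod.intCast_eq_intCast_iff_dvd_sub m t N).mp h1.symm
    exact ⟨k, by simp only; omega⟩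

theorem cast_sign_mul_cast (n : ℤ) : (n.sign : ℝ) * n = |(n : ℝ)| := by
  exact_mod_cast Int.sign_mul_self_eq_abs n

theorem WBt_eq_weilTheta_single {N : ℕ} [NeZero N] {l : ℕ} (hl : 0 < l) {n : ℤ} (hn : n ≠ 0)
    (hN : N = 2 * l * n.natAbs) (lam : ℕ) (j u : ℤ) :
    WBt l n j u lam =
      weilTheta N l n lam (Pi.single ((2 * l * j + n.sign * u : ℤ) : ZMod N) 1) := by
  have hn' : (n : ℝ) ≠ 0 := by exact_mod_cast hn
  have hl' : (0 : ℝ) < l := by exact_mod_cast hl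
  have hN' : (N : ℝ) = 2 * l * |(n : ℝ)| := by rw [hN]; push_cast [Nat.cast_natAbs]; rfl
  have hσ : (n.sign : ℝ) * n.sign = 1 := by exact_mod_cast sign_mul_sign_self hn
  have hσn := cast_sign_mul_cast n
  set ρ : ℝ := √|(n : ℝ)| with hρ
  have hρ2 : ρ ^ 2 = |(n : ℝ)| := Real.sq_sqrt (abs_nonneg _)
  have hρ0 : 0 < ρ := by positivity
  set a : ℝ := √(2 * l) with ha
  have ha2 : a ^ 2 = 2 * l := Real.sq_sqrt (by positivity)
  have ha0 : 0 < a := by positivity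
  have hsqrt : √N = a * ρ := by rw [hN', Real.sqrt_mul (by positivity)]
  ext x
  rw [weilTheta_single, WBt, WB]
  congr 1
  refine tsum_congr fun k => ?_
  obtain ⟨c, hc⟩ : ∃ c, c = (k : ℝ) + (j : ℝ) / |(n : ℝ)| + (u : ℝ) / (((2 * l : ℕ) : ℝ) * n) :=
    ⟨_, rfl⟩
  have hcN : ((N * k + (2 * l * j + n.sign * u) : ℤ) : ℝ) = 2 * l * |(n : ℝ)| * c := by
    rw [hc]
    push_cast
    rw [hN', mul_add, mul_add, ← hσn]
    have hσ0 : (n.sign : ℝ) ≠ 0 := left_ne_zero_of_mul_eq_one hσ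
    field_simp
    ring
  have harg : (√N)⁻¹ * (N * k + (2 * l * j + n.sign * u) : ℤ) + ρ * x.1 =
      ρ * a * (x.1 / a + c) := by
    rw [hcN, hsqrt, ← ha2, ← hρ2]
    field_simp
    ring
  rw [thetaTerm, add_assoc (_ + (k : ℝ)) , add_assoc (S2l l x).1, ← add_assoc (k : ℝ), ← hc]
  congr 1
  · rw [polyGauss_scaledHermite_mul, harg, Fnll, S2l, ← ha]
    have e1 : 2 * √(l * π * |(n : ℝ)|) = √(2 * π) * (ρ * a) := by
      rw [hρ, ha, ← Real.sqrt_mul (abs_nonneg _), ← Real.sqrt_mul (by positivity),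
        show 2 * π * (|(n : ℝ)| * (2 * l)) = 2 ^ 2 * (l * π * |(n : ℝ)|) by ring,
        Real.sqrt_mul (sq_nonneg 2), Real.sqrt_sq zero_le_two]
    rw [e1]
    congr 3
    · ring
    · rw [mul_pow, mul_pow, hρ2, ha2]
      ring
  · rw [S2l, ← ha]
    congr 1
    have e2 : ((n : ℝ) * c * (a * x.2.1)) = (n.sign / a * x.2.1) *
        ((N * k + (2 * l * j + n.sign * u) : ℤ) : ℝ) := by
      rw [hcN, ← ha2, ← hσn]
      field_simp
      linear_combination -(c * x.2.1) * hσ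
    have e3 := congrArg (fun y : ℝ => 2 * π * I * (y : ℂ)) e2
    simp only [Complex.ofReal_mul, Complex.ofReal_intCast] at e3
    rw [Complex.ofReal_mul, Complex.ofReal_mul]
    linear_combination e3

theorem I_zpow_eq {n : ℤ} (hn : n ≠ 0) :
    cexp (2 * π * I * n * (1 / 4)) = (I * n.sign) ^ n.natAbs := by
  have h : cexp (2 * π * I * (1 / 4)) = I := by
    rw [show 2 * π * I * (1 / 4) = π / 2 * I by ring, Complex.exp_pi_div_two_mul_I]
  have h1 : (I * n.sign) = cexp (n.sign * (2 * π * I * (1 / 4))) := by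
    rw [Complex.exp_int_mul, h]
    rcases hn.lt_or_gt with h | h
    · simp [Int.sign_eq_neg_one_of_neg h]
    · simp [Int.sign_eq_one_of_pos h]
  rw [h1, ← Complex.exp_nat_mul]
  have h2 : (n.sign * n.natAbs : ℂ) = n := by
    have := congrArg (Int.cast : ℤ → ℂ) (Int.sign_mul_natAbs n)
    rwa [Int.cast_mul, Int.cast_natCast] at this
  congr 1
  linear_combination -(2 * π * I * (1 / 4)) * h2

theorem weilTheta_comp_psi_single {N : ℕ} [NeZero N] {l : ℕ} (hl : 0 < l) {n : ℤ} (hn : n ≠ 0)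
    (hN : N = 2 * l * n.natAbs) (lam : ℕ) (m : ℤ) (x : H3) :
    weilTheta N l n lam (Pi.single (m : ZMod N) 1) (psi x) =
      weilTheta N l n lam (fun k => (I * n.sign) ^ (n.natAbs + lam) * (√N : ℂ)⁻¹ *
        ZMod.stdAddChar (-(m * (n.sign * k) : ZMod N))) x := by
  have hl' : (0 : ℝ) < l := by exact_mod_cast hl
  have hN' : (N : ℝ) = 2 * l * |(n : ℝ)| := by rw [hN]; push_cast [Nat.cast_natAbs]; rfl
  have hσ : (n.sign : ℝ) * n.sign = 1 := by exact_mod_cast sign_mul_sign_self hn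
  have hσn := cast_sign_mul_cast n
  obtain ⟨p, q, s⟩ := x
  set ρ : ℝ := √|(n : ℝ)| with hρ
  have hρ2 : ρ ^ 2 = |(n : ℝ)| := Real.sq_sqrt (abs_nonneg _)
  have hρ0 : 0 < ρ := by positivity
  set a : ℝ := √(2 * l) with ha
  have ha2 : a ^ 2 = 2 * l := Real.sq_sqrt (by positivity)
  have ha0 : 0 < a := by positivity
  have hsqrt : √N = a * ρ := by rw [hN', Real.sqrt_mul (by positivity)]
  have hA0 : 0 < √(N : ℝ) := by rw [hsqrt]; positivity
  have hNA : (N : ℝ) = √N * √N := by rw [Real.mul_self_sqrt (by positivity)]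
  set σ : ℤ := n.sign with hσdef
  rw [weilTheta_single, weilTheta_apply]
  have hl1 (k : ℤ) : thetaTerm N l n lam (psi (p, q, s)) (N * k + m) =
      cexp (2 * π * I * (σ / a * p * m : ℝ)) *
      (polyGauss (scaledHermite lam) (√N * k + ((√N)⁻¹ * m - ρ * q)) *
        cexp (2 * π * I * (σ / a * p * N : ℝ) * k)) := by
    rw [thetaTerm, mul_left_comm, ← Complex.exp_add]
    congr 2
    · simp only [psi, ← hρ]
      push_cast
      rw [mul_add, ← mul_assoc, show (√N)⁻¹ * (N : ℝ) = √N by nth_rw 2 [hNA]; field_simp]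
      ring
    · simp only [psi]
      push_cast
      ring
  simp_rw [hl1, tsum_mul_left]
  have hinv : Function.Involutive fun t : ℤ => -(σ * t) := fun t => by
    linear_combination t * sign_mul_sign_self hn
  rw [tsum_polyGauss_affine _ (fourier_polyGauss_scaledHermite lam) hA0,
    ← hinv.toPerm.tsum_eq]
  simp_rw [← tsum_mul_left]
  refine tsum_congr fun t => ?_
  have hG : polyGauss (scaledHermite lam) (((-(σ * t) : ℤ) - σ / a * p * N) / √N) =
      (-σ) ^ lam * polyGauss (scaledHermite lam) ((√N)⁻¹ * t + ρ * p) := by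
    have h1 : (((-(σ * t) : ℤ) - σ / a * p * N) / √N : ℝ) = -σ * ((√N)⁻¹ * t + ρ * p) := by
      nth_rw 1 [hNA]
      push_cast
      rw [hsqrt]
      field_simp
      ring
    rw [h1]
    rcases hn.lt_or_gt with h | h
    · simp [hσdef, Int.sign_eq_neg_one_of_neg h]
    · rw [hσdef, Int.sign_eq_one_of_pos h]
      simpa using polyGauss_scaledHermite_neg lam ((√N)⁻¹ * t + ρ * p)
  have hχ : (ZMod.stdAddChar (-(m * (σ * t)) : ZMod N) : ℂ) =
      cexp (2 * π * I * (-(m * (σ * t)) : ℤ) / N) := by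
    rw [← ZMod.stdAddChar_coe]
    push_cast
    rfl
  simp only [Function.Involutive.coe_toPerm, hG]
  rw [thetaTerm, hχ]
  have hE : cexp (2 * π * I * n * (psi (p, q, s)).2.2) * (cexp (2 * π * I * (σ / a * p * m : ℝ)) *
      cexp (2 * π * I * (((√N)⁻¹ * m - ρ * q : ℝ) / (√N : ℝ)) *
        ((-(σ * t) : ℤ) - (σ / a * p * N : ℝ)))) =
      cexp (2 * π * I * n * s) * (I * σ) ^ n.natAbs *
        (cexp (2 * π * I * (-(m * (σ * t)) : ℤ) / N) * cexp (2 * π * I * (σ / a * q : ℝ) * t)) := by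
    rw [← I_zpow_eq hn, ← Complex.exp_add, ← Complex.exp_add, ← Complex.exp_add,
      ← Complex.exp_add, ← Complex.exp_add]
    refine congrArg cexp ?_
    have hR : (n * (s + 1 / 4 - p * q) + (σ / a * p * m + ((√N)⁻¹ * m - ρ * q) / √N *
        (-(σ * t) - σ / a * p * N)) : ℝ) =
        n * s + n * (1 / 4) + (-(m * (σ * t)) / N + σ / a * q * t) := by
      have hnσ : (n : ℝ) = σ * ρ ^ 2 := by rw [hρ2, ← hσn]; linear_combination -n * hσ
      rw [hsqrt, show (N : ℝ) = (a * ρ) * (a * ρ) by rw [← hsqrt, ← hNA], hnσ]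
      field_simp
      ring
    have hC := congrArg (fun y : ℝ => 2 * π * I * (y : ℂ)) hR
    simp only [psi]
    push_cast at hC ⊢
    linear_combination hC
  have hI : (-I) ^ lam * ((-σ : ℂ)) ^ lam = (I * σ) ^ lam := by
    rw [← mul_pow]
    ring
  rw [pow_add, ← hI]
  linear_combination ((-I) ^ lam / (√N : ℝ) * ((-σ : ℂ) ^ lam *
    polyGauss (scaledHermite lam) ((√N)⁻¹ * t + ρ * p))) * hE

theorem weilTheta_comp_psi {N : ℕ} [NeZero N] {l : ℕ} (hl : 0 < l) {n : ℤ} (hn : n ≠ 0)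
    (hN : N = 2 * l * n.natAbs) (lam : ℕ) (c : ZMod N → ℂ) :
    weilTheta N l n lam c ∘ psi =
      weilTheta N l n lam ((scaledDFT N (I ^ (n.natAbs + lam)) ^ (if 0 < n then 1 else 3)) c) := by
  suffices h : LinearMap.funLeft ℂ ℂ psi ∘ₗ weilTheta N l n lam = weilTheta N l n lam ∘ₗ
      (scaledDFT N (I ^ (n.natAbs + lam)) ^ (if 0 < n then 1 else 3)) from LinearMap.congr_fun h c
  refine LinearMap.pi_ext' fun k => LinearMap.ext_ring (funext fun x => ?_)
  obtain ⟨m, rfl⟩ := ZMod.intCast_surjective k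
  refine (weilTheta_comp_psi_single hl hn hN lam m x).trans ?_
  refine congrFun (congrArg (weilTheta N l n lam) (funext fun k => ?_)) x
  rcases hn.lt_or_gt with h | h
  · rw [if_neg h.not_gt, Int.sign_eq_neg_one_of_neg h, pow_succ', Module.End.mul_apply, pow_two,
      Module.End.mul_apply, scaledDFT_sq_apply]
    have hI : (-I) ^ (n.natAbs + lam) = (I ^ (n.natAbs + lam)) ^ 2 * I ^ (n.natAbs + lam) := by
      rw [← I_pow_three]
      ring
    simp [hI, scaledDFT_apply, dft_single, mul_assoc]
  · rw [if_pos h, pow_one, Int.sign_eq_one_of_pos h]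
    simp [scaledDFT_apply, dft_single]

theorem weilTheta_comp_psi_eq_self_iff {N : ℕ} [NeZero N] {l : ℕ} (hl : 0 < l) {n : ℤ}
    (hn : n ≠ 0) (hN : N = 2 * l * n.natAbs) (lam : ℕ) (c : ZMod N → ℂ) :
    weilTheta N l n lam c ∘ psi = weilTheta N l n lam c ↔
      c ∈ LinearMap.ker (scaledDFT N (I ^ (n.natAbs + lam)) - 1) := by
  have h4 : scaledDFT N (I ^ (n.natAbs + lam)) ^ 4 = 1 :=
    scaledDFT_pow_four (by rw [← pow_mul, mul_comm, pow_mul, I_pow_four, one_pow])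
  rw [weilTheta_comp_psi hl hn hN, (weilTheta_injective N hl hn lam).eq_iff, LinearMap.mem_ker,
    LinearMap.sub_apply, sub_eq_zero, Module.End.one_apply]
  split_ifs
  · rw [pow_one]
  · refine ⟨fun h => ?_, fun h => ?_⟩
    · conv_lhs => rw [← h]
      rw [← Module.End.mul_apply, ← pow_succ', h4, Module.End.one_apply]
    · simp only [pow_succ, pow_zero, one_mul, Module.End.mul_apply, h]

theorem eigSpaceT_eq_range {N : ℕ} [NeZero N] {l : ℕ} (hl : 0 < l) {n : ℤ} (hn : n ≠ 0)
    (hN : N = 2 * l * n.natAbs) (lam : ℕ) :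
    eigSpaceT l n lam = LinearMap.range (weilTheta N l n lam) := by
  rw [eigSpaceT, LinearMap.range_eq_map, ← (Pi.basisFun ℂ (ZMod N)).span_eq, Submodule.map_span]
  congr 1
  ext f
  simp only [Set.mem_ofPred_eq, Set.mem_image, Set.mem_range, exists_exists_eq_and,
    Pi.basisFun_apply]
  constructor
  · rintro ⟨j, u, -, -, rfl⟩
    exact ⟨_, (WBt_eq_weilTheta_single hl hn hN lam j u).symm⟩
  · rintro ⟨k, rfl⟩
    obtain ⟨j, u, hj, hu, h⟩ : ∃ j u : ℕ, j < n.natAbs ∧ u < 2 * l ∧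
        ((2 * l * j + n.sign * u : ℤ) : ZMod N) = k := by
      have hdiv (k : ZMod N) : ∃ a r : ℕ, a < n.natAbs ∧ r < 2 * l ∧ (2 * l * a + r : ZMod N) = k :=
        ⟨k.val / (2 * l), k.val % (2 * l), Nat.div_lt_of_lt_mul (hN ▸ ZMod.val_lt k),
          Nat.mod_lt _ (by omega), by
            exact_mod_cast (congrArg Nat.cast (Nat.div_add_mod k.val (2 * l))).trans
              (ZMod.natCast_zmod_val k)⟩
      rcases hn.lt_or_gt with h | h
      · obtain ⟨a, r, ha, hr, hk⟩ := hdiv (-k)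
        rw [Int.sign_eq_neg_one_of_neg h]
        rcases Nat.eq_zero_or_pos a with rfl | h0
        · refine ⟨0, r, ha, hr, ?_⟩
          push_cast at hk ⊢
          linear_combination -hk
        · refine ⟨n.natAbs - a, r, by omega, hr, ?_⟩
          have hN0 : ((2 * l * n.natAbs : ℕ) : ZMod N) = 0 :=
            (ZMod.natCast_eq_zero_iff _ _).mpr hN.dvd
          generalize n.natAbs = b at ha hN0 ⊢
          push_cast [Nat.cast_sub ha.le] at hN0 ⊢
          linear_combination hN0 - hk
      · obtain ⟨a, r, ha, hr, hk⟩ := hdiv k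
        exact ⟨a, r, ha, hr, by rw [Int.sign_eq_one_of_pos h, ← hk]; push_cast; ring⟩
    exact ⟨j, u, hj, hu, by rw [WBt_eq_weilTheta_single hl hn hN, h]⟩

theorem finrank_eigSpacePsi {N : ℕ} [NeZero N] {l : ℕ} (hl : 0 < l) {n : ℤ} (hn : n ≠ 0)
    (hN : N = 2 * l * n.natAbs) (lam : ℕ) :
    Module.finrank ℂ (eigSpacePsi l n lam) =
      Module.finrank ℂ (LinearMap.ker (scaledDFT N (I ^ (n.natAbs + lam)) - 1)) := by
  have h : eigSpacePsi l n lam =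
      (LinearMap.ker (scaledDFT N (I ^ (n.natAbs + lam)) - 1)).map (weilTheta N l n lam) := by
    ext f
    rw [eigSpacePsi, eigSpaceT_eq_range hl hn hN, Submodule.mem_inf, Submodule.mem_map,
      LinearMap.mem_range, LinearMap.mem_ker (f := LinearMap.funLeft ℂ ℂ psi - LinearMap.id),
      LinearMap.sub_apply, sub_eq_zero]
    constructor
    · rintro ⟨⟨c, rfl⟩, hc⟩
      exact ⟨c, (weilTheta_comp_psi_eq_self_iff hl hn hN lam c).mp hc, rfl⟩
    · rintro ⟨c, hc, rfl⟩
      exact ⟨⟨c, rfl⟩, (weilTheta_comp_psi_eq_self_iff hl hn hN lam c).mpr hc⟩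
  rw [h]
  exact (Submodule.equivMapOfInjective _ (weilTheta_injective N hl hn lam) _).finrank_eq.symm

theorem four_mul_finrank_eigSpacePsi {l : ℕ} (hl : 0 < l) {n : ℤ} (hn : n ≠ 0) (lam : ℕ) :
    (4 * Module.finrank ℂ (eigSpacePsi l n lam) : ℤ) = 2 * (l * n.natAbs) +
      (if (n.natAbs + lam) % 2 = 0 then 2 else -2) +
      if Even (l * n.natAbs) then
        (if (n.natAbs + lam) % 4 ≤ 1 then 2 else -2) else 0 := by
  have : NeZero (2 * l * n.natAbs) := ⟨by simpa [hn] using hl.ne'⟩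
  have h2 : I ^ 2 = -1 := I_sq
  have h3 : I ^ 3 = -I := I_pow_three
  have h := four_mul_finrank_ker_scaledDFT (N := 2 * l * n.natAbs) (by simp [mul_assoc])
    (κ := I ^ (n.natAbs + lam)) (by rw [← pow_mul, mul_comm, pow_mul, I_pow_four, one_pow])
  rw [← finrank_eigSpacePsi hl hn rfl] at h
  have h4 : 4 ∣ 2 * l * n.natAbs ↔ Even (l * n.natAbs) := by
    rw [even_iff_two_dvd, mul_assoc, show 4 = 2 * 2 from rfl, Nat.mul_dvd_mul_iff_left two_pos]
  simp only [h4] at h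
  rw [← Int.cast_inj (α := ℂ)]
  push_cast
  rw [h, I_pow_eq_pow_mod]
  have hr : (n.natAbs + lam) % 2 = (n.natAbs + lam) % 4 % 2 := by omega
  rw [hr]
  have hlt : (n.natAbs + lam) % 4 < 4 := Nat.mod_lt _ (by norm_num)
  generalize (n.natAbs + lam) % 4 = r at hlt
  interval_cases r <;> split_ifs <;> push_cast <;> try simp_all
  all_goals first
    | ring1
    | linear_combination (-2) * I_sq
    | linear_combination (2 - I - I ^ 2) * I_sq

end WeilTheta

/-- dimensions of the spaces of ψ-invariant eigenfunctions. -/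
theorem dim_psi_invariant_eigenspace (l : ℕ) (hl : 0 < l) (n : ℤ) (hn : n ≠ 0)
    (lam : ℕ) :
    ((Even n.natAbs ∨ Even l) →
      (((n.natAbs + lam) % 4 = 0 →
          Module.finrank ℂ (eigSpacePsi l n lam) = l * n.natAbs / 2 + 1) ∧
       ((n.natAbs + lam) % 4 = 1 ∨ (n.natAbs + lam) % 4 = 2 →
          Module.finrank ℂ (eigSpacePsi l n lam) = l * n.natAbs / 2) ∧
       ((n.natAbs + lam) % 4 = 3 →
          Module.finrank ℂ (eigSpacePsi l n lam) = l * n.natAbs / 2 - 1))) ∧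
    ((Odd n.natAbs ∧ Odd l) →
      (((n.natAbs + lam) % 4 = 0 ∨ (n.natAbs + lam) % 4 = 2 →
          Module.finrank ℂ (eigSpacePsi l n lam) = (l * n.natAbs + 1) / 2) ∧
       ((n.natAbs + lam) % 4 = 1 ∨ (n.natAbs + lam) % 4 = 3 →
          Module.finrank ℂ (eigSpacePsi l n lam) = (l * n.natAbs - 1) / 2))) := by
  have h := four_mul_finrank_eigSpacePsi hl hn lam
  have hpar : (Even n.natAbs ∨ Even l) ↔ Even (l * n.natAbs) := by rw [Nat.even_mul, or_comm]
  have hodd : (Odd n.natAbs ∧ Odd l) ↔ ¬Even (l * n.natAbs) := by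
    rw [Nat.not_even_iff_odd, Nat.odd_mul, and_comm]
  rw [← Nat.cast_mul] at h
  rw [hpar, hodd]
  generalize Module.finrank ℂ (eigSpacePsi l n lam) = d at h ⊢
  generalize l * n.natAbs = L at h ⊢
  generalize n.natAbs + lam = s at h ⊢
  simp only [Nat.even_iff] at h ⊢
  split_ifs at h <;> omega

end
end
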